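/- Let d ≥ 1, 1 < q < d+2, β ∈ (1, (d+2)/q], and let r satisfy r(β − 1) = qβ. Then there exists a constant N = N(d, q, β) such that for every u ∈ C_0^∞(ℝ^{d+1}) and all −∞ < S < T < ∞, with Q_{S,T} = (S,T) × ℝ^d, one has ‖Du‖_{E_{r, β−1}(Q_{S,T})} ≤ N ‖ |∂_t u| + |Δu| ‖_{E_{q, β}(Q_{S,T})} + N (T−S)^{-1} ‖u‖_{E_{q, β}(Q_{S,T})}. -/

import Mathlib

open MeasureTheory Set ENNReal Filter

noncomputable section

/-- Euclidean space `ℝ^d`. -/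
abbrev Ed (d : ℕ) := EuclideanSpace ℝ (Fin d)

/-- Points of `ℝ^{d+1}`: `z = (t, x)`. -/
abbrev Pt (d : ℕ) := ℝ × Ed d

/-- The parabolic cylinder `C_ρ(t,x)`. -/
def pCyl (d : ℕ) (ρ : ℝ) (z : Pt d) : Set (Pt d) :=
  {w | dist z.2 w.2 < ρ ∧ z.1 ≤ w.1 ∧ w.1 < z.1 + ρ ^ 2}

/-- The average `⨍_{C_ρ(z)} f`. -/
def pAvg (d : ℕ) (ρ : ℝ) (z : Pt d) (f : Pt d → ℝ≥0∞) : ℝ≥0∞ :=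
  (volume (pCyl d ρ z))⁻¹ * ∫⁻ w in pCyl d ρ z, f w

/-- The fractional maximal function `M_β f`. -/
def Mbeta (d : ℕ) (β : ℝ) (f : Pt d → ℝ≥0∞) (z : Pt d) : ℝ≥0∞ :=
  ⨆ (ρ : ℝ) (_ : 0 < ρ), ENNReal.ofReal (ρ ^ β) * pAvg d ρ z f

/-- The kernel `p_α(s, r)`. -/
def pKer (d : ℕ) (α : ℝ) (s r : ℝ) : ℝ≥0∞ :=
  if 0 < s then ENNReal.ofReal (s ^ (-(((d : ℝ) + 2 - α) / 2)) * Real.exp (-(r ^ 2) / s)) else 0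

/-- The parabolic potential `P_α f`. -/
def Palpha (d : ℕ) (α : ℝ) (f : Pt d → ℝ≥0∞) (z : Pt d) : ℝ≥0∞ :=
  ∫⁻ w : Pt d, pKer d α w.1 ‖w.2‖ * f (z.1 + w.1, z.2 + w.2)

/-- The parabolic Morrey norm `‖f‖_{E_{p,β}(Q)}`. -/
def MorreyNorm (d : ℕ) (p β : ℝ) (Q : Set (Pt d)) (f : Pt d → ℝ≥0∞) : ℝ≥0∞ :=
  ⨆ (ρ : ℝ) (_ : 0 < ρ) (z : Pt d) (_ : z ∈ Q),
    ENNReal.ofReal (ρ ^ β) * (pAvg d ρ z fun w => Q.indicator f w ^ p) ^ (1 / p)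

/-- The `L_p`-norm on `ℝ^{d+1}`. -/
def LpNormE (d : ℕ) (p : ℝ) (f : Pt d → ℝ≥0∞) : ℝ≥0∞ :=
  (∫⁻ z : Pt d, f z ^ p) ^ (1 / p)

/-- The mixed norm `‖f‖_{L_{q₁,q₂}}`. -/
def MixedNorm (d : ℕ) (q₁ q₂ : ℝ) (f : Pt d → ℝ≥0∞) : ℝ≥0∞ :=
  (∫⁻ t : ℝ, (∫⁻ x : Ed d, f (t, x) ^ q₁) ^ (q₂ / q₁)) ^ (1 / q₂)

/-- The normalized mixed norm `‖f‖_{L_{q₁,q₂}(Γ)}`. -/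
def MixedNormOn (d : ℕ) (q₁ q₂ : ℝ) (Γ : Set (Pt d)) (f : Pt d → ℝ≥0∞) : ℝ≥0∞ :=
  (MixedNorm d q₁ q₂ (Γ.indicator 1))⁻¹ * MixedNorm d q₁ q₂ (Γ.indicator f)

/-- The mixed-norm parabolic Morrey norm `‖f‖_{E_{q₁,q₂,β}(Q)}`. -/
def MixedMorrey (d : ℕ) (q₁ q₂ β : ℝ) (Q : Set (Pt d)) (f : Pt d → ℝ≥0∞) : ℝ≥0∞ :=
  ⨆ (ρ : ℝ) (_ : 0 < ρ) (z : Pt d) (_ : z ∈ Q),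
    ENNReal.ofReal (ρ ^ β) * MixedNormOn d q₁ q₂ (pCyl d ρ z) (Q.indicator f)

/-- The symmetric parabolic maximal function `M̂ f`. -/
def pMax (d : ℕ) (f : Pt d → ℝ≥0∞) (z : Pt d) : ℝ≥0∞ :=
  ⨆ (r : ℝ) (_ : 0 < r) (w : Pt d) (_ : z ∈ pCyl d r w), pAvg d r w f

/-- The time derivative `∂_t u`. -/
def timeDeriv (d : ℕ) (u : Pt d → ℝ) (z : Pt d) : ℝ :=
  fderiv ℝ u z ((1 : ℝ), (0 : Ed d))

/-- The spatial partial derivative `D_i u`. -/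
def spDeriv (d : ℕ) (i : Fin d) (u : Pt d → ℝ) (z : Pt d) : ℝ :=
  fderiv ℝ u z ((0 : ℝ), EuclideanSpace.single i (1 : ℝ))

/-- The Euclidean norm of the spatial gradient `|Du|`. -/
def gradNorm (d : ℕ) (u : Pt d → ℝ) (z : Pt d) : ℝ :=
  Real.sqrt (∑ i : Fin d, spDeriv d i u z ^ 2)

/-- The spatial Laplacian `Δu`. -/
def lap (d : ℕ) (u : Pt d → ℝ) (z : Pt d) : ℝ :=
  ∑ i : Fin d, spDeriv d i (spDeriv d i u) z

/-- The (Frobenius) norm of the spatial Hessian `|D²u|`. -/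
def hessNorm (d : ℕ) (u : Pt d → ℝ) (z : Pt d) : ℝ :=
  Real.sqrt (∑ i : Fin d, ∑ j : Fin d, spDeriv d i (spDeriv d j u) z ^ 2)


/-- Symmetric parabolic cylinder. -/
def sCyl (d : ℕ) (ρ : ℝ) (z : Pt d) : Set (Pt d) :=
  Metric.ball z.1 (ρ ^ 2) ×ˢ Metric.ball z.2 ρ

/-- Average over the symmetric cylinder. -/
def sAvg (d : ℕ) (ρ : ℝ) (z : Pt d) (f : Pt d → ℝ≥0∞) : ℝ≥0∞ :=
  (volume (sCyl d ρ z))⁻¹ * ∫⁻ w in sCyl d ρ z, f w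

/-- Uncentered maximal function. -/
def sMax (d : ℕ) (f : Pt d → ℝ≥0∞) (z : Pt d) : ℝ≥0∞ :=
  ⨆ (r : ℝ) (_ : 0 < r) (w : Pt d) (_ : z ∈ sCyl d r w), sAvg d r w f

/-- volume of the unit ball. -/
def omegaD (d : ℕ) : ℝ≥0∞ := volume (Metric.ball (0 : Ed d) 1)

lemma omegaD_pos (d : ℕ) : omegaD d ≠ 0 := (Metric.measure_ball_pos _ _ one_pos).ne'
lemma omegaD_fin (d : ℕ) : omegaD d ≠ ∞ := measure_ball_lt_top.ne

lemma vol_ball_d (d : ℕ) (x : Ed d) {ρ : ℝ} (hρ : 0 < ρ) :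
    volume (Metric.ball x ρ) = ENNReal.ofReal (ρ ^ d) * omegaD d := by
  have := Measure.addHaar_ball_of_pos (μ := (volume : Measure (Ed d))) x hρ
  simpa [omegaD] using this

lemma vol_sCyl (d : ℕ) {ρ : ℝ} (hρ : 0 < ρ) (z : Pt d) :
    volume (sCyl d ρ z) = 2 * omegaD d * ENNReal.ofReal (ρ ^ (d + 2)) := by
  rw [sCyl, Measure.volume_eq_prod, Measure.prod_prod, Real.volume_ball, vol_ball_d d _ hρ,
    ENNReal.ofReal_mul (by norm_num), pow_add, ENNReal.ofReal_mul (by positivity)]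
  simp only [ENNReal.ofReal_ofNat]
  ring

lemma vol_pCyl (d : ℕ) {ρ : ℝ} (hρ : 0 < ρ) (z : Pt d) :
    volume (pCyl d ρ z) = omegaD d * ENNReal.ofReal (ρ ^ (d + 2)) := by
  have : pCyl d ρ z = Ico z.1 (z.1 + ρ ^ 2) ×ˢ Metric.ball z.2 ρ := by
    ext w
    simp only [pCyl, mem_ofPred_eq, mem_prod, mem_Ico, Metric.mem_ball, dist_comm w.2]
    tauto
  rw [this, Measure.volume_eq_prod, Measure.prod_prod, Real.volume_Ico, vol_ball_d d _ hρ,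
    pow_add, ENNReal.ofReal_mul (by positivity)]
  simp only [add_sub_cancel_left]
  ring

lemma measurableSet_pCyl (d : ℕ) (ρ : ℝ) (z : Pt d) : MeasurableSet (pCyl d ρ z) := by
  have : pCyl d ρ z = Ico z.1 (z.1 + ρ ^ 2) ×ˢ Metric.ball z.2 ρ := by
    ext w
    simp only [pCyl, mem_ofPred_eq, mem_prod, mem_Ico, Metric.mem_ball, dist_comm w.2]
    tauto
  rw [this]
  exact measurableSet_Ico.prod Metric.isOpen_ball.measurableSet

lemma isOpen_sCyl (d : ℕ) (ρ : ℝ) (z : Pt d) : IsOpen (sCyl d ρ z) :=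
  Metric.isOpen_ball.prod Metric.isOpen_ball

lemma measurableSet_sCyl (d : ℕ) (ρ : ℝ) (z : Pt d) : MeasurableSet (sCyl d ρ z) :=
  (isOpen_sCyl d ρ z).measurableSet

lemma self_mem_sCyl (d : ℕ) {ρ : ℝ} (hρ : 0 < ρ) (z : Pt d) : z ∈ sCyl d ρ z :=
  ⟨Metric.mem_ball_self (by positivity), Metric.mem_ball_self hρ⟩

lemma vol_sCyl_ne_zero (d : ℕ) {ρ : ℝ} (hρ : 0 < ρ) (z : Pt d) : volume (sCyl d ρ z) ≠ 0 := by
  rw [vol_sCyl d hρ]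
  have := omegaD_pos d
  have : 0 < ρ ^ (d+2) := by positivity
  simp_all

lemma vol_sCyl_ne_top (d : ℕ) {ρ : ℝ} (hρ : 0 < ρ) (z : Pt d) : volume (sCyl d ρ z) ≠ ∞ := by
  rw [vol_sCyl d hρ]
  exact ENNReal.mul_ne_top (ENNReal.mul_ne_top (by simp) (omegaD_fin d)) (by simp)

lemma vol_sCyl_scale (d : ℕ) {c ρ : ℝ} (hc : 0 < c) (hρ : 0 < ρ) (z : Pt d) (z' : Pt d) :
    volume (sCyl d (c * ρ) z) = ENNReal.ofReal (c ^ (d + 2)) * volume (sCyl d ρ z') := by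
  rw [vol_sCyl d hρ, vol_sCyl d (by positivity), mul_pow, ENNReal.ofReal_mul (by positivity)]
  ring

lemma lt_sMax_iff (d : ℕ) (f : Pt d → ℝ≥0∞) (z : Pt d) (l : ℝ≥0∞) :
    l < sMax d f z ↔ ∃ (r : ℝ) (w : Pt d), 0 < r ∧ z ∈ sCyl d r w ∧ l < sAvg d r w f := by
  simp only [sMax, lt_iSup_iff]
  constructor
  · rintro ⟨r, hr, w, hw, h⟩; exact ⟨r, w, hr, hw, h⟩
  · rintro ⟨r, w, hr, hw, h⟩; exact ⟨r, hr, w, hw, h⟩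

lemma isOpen_lt_sMax (d : ℕ) (f : Pt d → ℝ≥0∞) (l : ℝ≥0∞) : IsOpen {z | l < sMax d f z} := by
  rw [isOpen_iff_mem_nhds]
  intro z hz
  obtain ⟨r, w, hr, hw, h⟩ := (lt_sMax_iff d f z l).1 hz
  filter_upwards [(isOpen_sCyl d r w).mem_nhds hw] with z' hz'
  exact (lt_sMax_iff d f z' l).2 ⟨r, w, hr, hz', h⟩

lemma measurable_sMax (d : ℕ) (f : Pt d → ℝ≥0∞) : Measurable (sMax d f) :=
  measurable_of_Ioi fun l => (isOpen_lt_sMax d f l).measurableSet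

lemma sAvg_mono {d : ℕ} {ρ : ℝ} {z : Pt d} {f g : Pt d → ℝ≥0∞}
    (h : ∀ w ∈ sCyl d ρ z, f w ≤ g w) : sAvg d ρ z f ≤ sAvg d ρ z g := by
  unfold sAvg
  exact mul_le_mul_right (setLIntegral_mono' (measurableSet_sCyl d ρ z) h) _

lemma lt_sAvg_iff {d : ℕ} {ρ : ℝ} (hρ : 0 < ρ) {z : Pt d} {f : Pt d → ℝ≥0∞} {l : ℝ≥0∞} :
    l < sAvg d ρ z f ↔ l * volume (sCyl d ρ z) < ∫⁻ w in sCyl d ρ z, f w := by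
  unfold sAvg
  rw [mul_comm, ← div_eq_mul_inv, ENNReal.lt_div_iff_mul_lt
    (Or.inl (vol_sCyl_ne_zero d hρ z)) (Or.inl (vol_sCyl_ne_top d hρ z))]

lemma weak_type (d : ℕ) (f : Pt d → ℝ≥0∞) {l : ℝ} (hl : 0 < l) :
    volume {z | ENNReal.ofReal l < sMax d f z} ≤
      ENNReal.ofReal (5 ^ (d + 2)) * (ENNReal.ofReal l)⁻¹ * ∫⁻ z, f z := by
  have hl0 : ENNReal.ofReal l ≠ 0 := by simpa using hl
  by_cases hf : ∫⁻ z, f z = ∞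
  · rw [hf, ENNReal.mul_top]
    · exact le_top
    · have : 0 < (5:ℝ) ^ (d+2) := by positivity
      simp
  let t : Set (ℝ × Pt d) := {a | 0 < a.1 ∧ ENNReal.ofReal l < sAvg d a.1 a.2 f}
  have ht : ∀ a ∈ t, ENNReal.ofReal l * volume (sCyl d a.1 a.2) < ∫⁻ w in sCyl d a.1 a.2, f w :=
    fun a ha => (lt_sAvg_iff ha.1).1 ha.2
  let V : ℝ := ((∫⁻ z, f z) / (ENNReal.ofReal l * (2 * omegaD d))).toReal
  have hden0 : ENNReal.ofReal l * (2 * omegaD d) ≠ 0 := by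
    have := omegaD_pos d
    simp_all
  have hdenT : ENNReal.ofReal l * (2 * omegaD d) ≠ ∞ :=
    ENNReal.mul_ne_top (by simp) (ENNReal.mul_ne_top (by simp) (omegaD_fin d))
  have hbd : ∀ a ∈ t, a.1 ≤ max 1 V := by
    intro a ha
    have h1 := (ht a ha).le.trans (setLIntegral_le_lintegral _ _)
    rw [vol_sCyl d ha.1, ← mul_assoc] at h1
    have h2 : ENNReal.ofReal (a.1 ^ (d+2)) ≤ (∫⁻ z, f z) / (ENNReal.ofReal l * (2 * omegaD d)) := by
      rw [ENNReal.le_div_iff_mul_le (Or.inl hden0) (Or.inl hdenT), mul_comm]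
      exact h1
    have h3 : a.1 ^ (d+2) ≤ V :=
      (ENNReal.ofReal_le_iff_le_toReal (ENNReal.div_ne_top hf hden0)).1 h2
    by_contra! hcon
    have h4 : 1 < a.1 := (le_max_left _ _).trans_lt hcon
    have h5 : V < a.1 := (le_max_right _ _).trans_lt hcon
    have h6 : a.1 ^ 1 ≤ a.1 ^ (d+2) := pow_le_pow_right₀ h4.le (by omega)
    linarith [pow_one a.1]
  obtain ⟨u, hut, hdisj, hcov⟩ := Vitali.exists_disjoint_subfamily_covering_enlargement
    (fun a : ℝ × Pt d => sCyl d a.1 a.2) t (fun a => a.1) 2 (by norm_num)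
    (fun a ha => ha.1.le) (max 1 V) hbd (fun a ha => ⟨_, self_mem_sCyl d ha.1 a.2⟩)
  have hcount : u.Countable := hdisj.countable_of_isOpen (fun a _ => isOpen_sCyl d _ _)
    (fun a ha => ⟨_, self_mem_sCyl d (hut ha).1 a.2⟩)
  have hsub : {z | ENNReal.ofReal l < sMax d f z} ⊆ ⋃ b ∈ u, sCyl d (5 * b.1) b.2 := by
    intro z hz
    obtain ⟨r, w, hr, hw, h⟩ := (lt_sMax_iff d f z _).1 hz
    obtain ⟨b, hb, ⟨y, hy1, hy2⟩, hrb⟩ := hcov (r, w) ⟨hr, h⟩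
    simp only [mem_iUnion]
    refine ⟨b, hb, ?_⟩
    simp only at hy1 hy2 hrb
    have hb0 := (hut hb).1
    simp only [sCyl, mem_prod, Metric.mem_ball] at hw hy1 hy2 ⊢
    constructor
    · have := dist_triangle4 z.1 w.1 y.1 b.2.1
      rw [dist_comm w.1 y.1] at this
      nlinarith [hw.1, hy1.1, hy2.1]
    · have := dist_triangle4 z.2 w.2 y.2 b.2.2
      rw [dist_comm w.2 y.2] at this
      linarith [hw.2, hy1.2, hy2.2]
  calc volume {z | ENNReal.ofReal l < sMax d f z}
      ≤ volume (⋃ b ∈ u, sCyl d (5 * b.1) b.2) := measure_mono hsub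
    _ ≤ ∑' b : u, volume (sCyl d (5 * b.1.1) b.1.2) := measure_biUnion_le _ hcount _
    _ ≤ ∑' b : u, ENNReal.ofReal (5 ^ (d + 2)) * (ENNReal.ofReal l)⁻¹ *
          ∫⁻ w in sCyl d b.1.1 b.1.2, f w := by
        refine ENNReal.tsum_le_tsum fun b => ?_
        have hb := hut b.2
        rw [vol_sCyl_scale d (by norm_num) hb.1 b.1.2 b.1.2, mul_assoc]
        gcongr
        rw [mul_comm, ← div_eq_mul_inv, ENNReal.le_div_iff_mul_le (Or.inl hl0) (Or.inl (by simp)),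
          mul_comm]
        exact (ht _ hb).le
    _ = ENNReal.ofReal (5 ^ (d + 2)) * (ENNReal.ofReal l)⁻¹ *
          ∫⁻ w in ⋃ b ∈ u, sCyl d b.1 b.2, f w := by
        rw [ENNReal.tsum_mul_left, lintegral_biUnion hcount
          (fun b _ => measurableSet_sCyl d _ _) hdisj]
    _ ≤ _ := by
        exact mul_le_mul_right (setLIntegral_le_lintegral _ _) _

lemma layer_fin {p : ℝ} (hp : 0 < p) {x : ℝ} (hx : 0 ≤ x) :
    (ENNReal.ofReal x) ^ p = ENNReal.ofReal p * ∫⁻ l in Ioi (0:ℝ),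
      (if ENNReal.ofReal l < ENNReal.ofReal x then ENNReal.ofReal (l ^ (p - 1)) else 0) := by
  have h := lintegral_rpow_eq_lintegral_meas_lt_mul (Measure.dirac ()) (f := fun _ => x)
    (Eventually.of_forall fun _ => hx) (by fun_prop) hp
  rw [lintegral_dirac] at h
  rw [ENNReal.ofReal_rpow_of_nonneg hx hp.le, h]
  congr 1
  refine setLIntegral_congr_fun measurableSet_Ioi fun l hl => ?_
  simp only [mem_Ioi] at hl
  have := ENNReal.ofReal_lt_ofReal_iff_of_nonneg (q := x) hl.le
  by_cases hlx : l < x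
  · rw [if_pos (this.2 hlx)]; simp [hlx]
  · rw [if_neg (fun h => hlx (this.1 h))]; simp [hlx]

lemma layer {p : ℝ} (hp : 0 < p) (x : ℝ≥0∞) :
    x ^ p = ENNReal.ofReal p * ∫⁻ l in Ioi (0:ℝ),
      (if ENNReal.ofReal l < x then ENNReal.ofReal (l ^ (p - 1)) else 0) := by
  by_cases hx : x = ∞
  · subst hx
    rw [ENNReal.top_rpow_of_pos hp]
    symm
    refine ENNReal.eq_top_of_forall_nnreal_le ?_
    intro a
    have h := layer_fin hp (x := (a:ℝ) ^ (1 / p)) (by positivity)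
    calc (a : ℝ≥0∞) = (ENNReal.ofReal ((a:ℝ) ^ (1 / p))) ^ p := by
          rw [ENNReal.ofReal_rpow_of_nonneg (by positivity) hp.le, ← Real.rpow_mul (by positivity),
            one_div, inv_mul_cancel₀ hp.ne', Real.rpow_one, ENNReal.ofReal_coe_nnreal]
      _ ≤ _ := by
          rw [h]
          gcongr with l
          simp
          split_ifs <;> simp
  · lift x to NNReal using hx
    have h := layer_fin hp (x := (x:ℝ)) (by positivity)
    simpa using h

lemma strong_type (d : ℕ) {q : ℝ} (hq : 1 < q) : ∃ C : ℝ, 0 < C ∧ ∀ f : Pt d → ℝ≥0∞,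
    Measurable f → ∫⁻ z, sMax d f z ^ q ≤ ENNReal.ofReal C * ∫⁻ z, f z ^ q := by
  have hq1 : 0 < q - 1 := by linarith
  refine ⟨q * (2 * 5 ^ (d+2)) * ((q-1)⁻¹ * 2 ^ (q-1)), by positivity, fun f hf => ?_⟩
  have hM := measurable_sMax d f
  have key : ∀ l : ℝ, 0 < l → volume {z | ENNReal.ofReal l < sMax d f z} ≤
      ENNReal.ofReal (2 * 5 ^ (d+2)) * (ENNReal.ofReal l)⁻¹ *
        ∫⁻ z, (if ENNReal.ofReal l < 2 * f z then f z else 0) := by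
    intro l hl
    have hsub : {z | ENNReal.ofReal l < sMax d f z} ⊆ {z | ENNReal.ofReal (l/2) <
        sMax d (fun z => if ENNReal.ofReal l < 2 * f z then f z else 0) z} := by
      intro z hz
      obtain ⟨r, w, hr, hw, h⟩ := (lt_sMax_iff d f z _).1 hz
      refine (lt_sMax_iff d _ z _).2 ⟨r, w, hr, hw, ?_⟩
      rw [lt_sAvg_iff hr] at h ⊢
      by_contra! hcon
      refine absurd h (not_lt.2 ?_)
      calc ∫⁻ w in sCyl d r w, f w ≤ ∫⁻ w in sCyl d r w, (ENNReal.ofReal (l/2) +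
            (if ENNReal.ofReal l < 2 * f w then f w else 0)) := by
            gcongr with y
            split_ifs with hy
            · exact le_add_self
            · rw [not_lt] at hy
              rw [add_zero, ENNReal.ofReal_div_of_pos (by norm_num), ENNReal.le_div_iff_mul_le
                (by simp) (by simp)]
              simpa [mul_comm] using hy
        _ = ENNReal.ofReal (l/2) * volume (sCyl d r w) +
            ∫⁻ w in sCyl d r w, (if ENNReal.ofReal l < 2 * f w then f w else 0) := by
            rw [lintegral_add_left measurable_const, setLIntegral_const]
        _ ≤ ENNReal.ofReal (l/2) * volume (sCyl d r w) +
            ENNReal.ofReal (l/2) * volume (sCyl d r w) := by gcongr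
        _ = ENNReal.ofReal l * volume (sCyl d r w) := by
            rw [← add_mul, ← ENNReal.ofReal_add (by positivity) (by positivity), add_halves]
    refine (measure_mono hsub).trans ((weak_type d _ (by positivity)).trans_eq ?_)
    congr 1
    rw [ENNReal.ofReal_div_of_pos (by norm_num), ENNReal.inv_div (by simp) (by simp),
      ENNReal.ofReal_mul (by norm_num), div_eq_mul_inv]
    ring
  have hset : MeasurableSet {p : Pt d × ℝ | ENNReal.ofReal p.2 < sMax d f p.1} :=
    measurableSet_lt (by fun_prop) (hM.comp measurable_fst)
  have hset2 : MeasurableSet {p : ℝ × Pt d | ENNReal.ofReal p.1 < 2 * f p.2} :=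
    measurableSet_lt (by fun_prop) (by fun_prop)
  calc ∫⁻ z, sMax d f z ^ q
      = ∫⁻ z, ENNReal.ofReal q * ∫⁻ l in Ioi (0:ℝ),
          (if ENNReal.ofReal l < sMax d f z then ENNReal.ofReal (l ^ (q - 1)) else 0) := by
        congr with z
        exact layer (by linarith) _
    _ = ENNReal.ofReal q * ∫⁻ l in Ioi (0:ℝ), ∫⁻ z,
          (if ENNReal.ofReal l < sMax d f z then ENNReal.ofReal (l ^ (q - 1)) else 0) := by
        rw [lintegral_const_mul' _ _ (by simp), lintegral_lintegral_swap]
        refine Measurable.aemeasurable ?_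
        exact Measurable.ite hset (by fun_prop) measurable_const
    _ ≤ ENNReal.ofReal q * ∫⁻ l in Ioi (0:ℝ), ENNReal.ofReal (2 * 5 ^ (d+2)) * ∫⁻ z,
          f z * (if ENNReal.ofReal l < 2 * f z then ENNReal.ofReal (l ^ (q - 1 - 1)) else 0) := by
        refine mul_le_mul_right (setLIntegral_mono' measurableSet_Ioi fun l hl => ?_) _
        have hl : 0 < l := hl
        have e1 : ∫⁻ z, (if ENNReal.ofReal l < sMax d f z then ENNReal.ofReal (l ^ (q - 1)) else 0)
          = ENNReal.ofReal (l ^ (q-1)) * volume {z | ENNReal.ofReal l < sMax d f z} := by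
          rw [← setLIntegral_const, ← lintegral_indicator (isOpen_lt_sMax d f _).measurableSet]
          simp only [indicator_apply, mem_ofPred_eq]
        have e2 : ∫⁻ z, f z * (if ENNReal.ofReal l < 2 * f z then
            ENNReal.ofReal (l ^ (q - 1 - 1)) else 0) = ENNReal.ofReal (l ^ (q - 1 - 1)) *
            ∫⁻ z, (if ENNReal.ofReal l < 2 * f z then f z else 0) := by
          rw [← lintegral_const_mul' _ _ (by simp)]
          congr with z
          split_ifs
          · ring
          · simp
        rw [e1, e2]
        refine (mul_le_mul_right (key l hl) _).trans_eq ?_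
        have : ENNReal.ofReal (l ^ (q - 1 - 1)) = ENNReal.ofReal (l ^ (q-1)) *
            (ENNReal.ofReal l)⁻¹ := by
          rw [Real.rpow_sub_one hl.ne', ENNReal.ofReal_div_of_pos hl, div_eq_mul_inv]
        rw [this]
        ring
    _ = ENNReal.ofReal q * ENNReal.ofReal (2 * 5 ^ (d+2)) * ∫⁻ z, f z * ∫⁻ l in Ioi (0:ℝ),
          (if ENNReal.ofReal l < 2 * f z then ENNReal.ofReal (l ^ (q - 1 - 1)) else 0) := by
        rw [lintegral_const_mul' _ _ ENNReal.ofReal_ne_top, lintegral_lintegral_swap, mul_assoc]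
        · congr with z
          rw [lintegral_const_mul]
          refine Measurable.ite ?_ (by fun_prop) measurable_const
          exact hset2.preimage (measurable_id.prodMk measurable_const)
        · refine Measurable.aemeasurable ?_
          exact Measurable.mul (by fun_prop) (Measurable.ite hset2 (by fun_prop) measurable_const)
    _ = ENNReal.ofReal q * ENNReal.ofReal (2 * 5 ^ (d+2)) * ∫⁻ z,
          (ENNReal.ofReal ((q-1)⁻¹) * ENNReal.ofReal (2 ^ (q-1))) * f z ^ q := by
        congr with z
        have h := layer hq1 (2 * f z)
        have h2 : ∫⁻ l in Ioi (0:ℝ), (if ENNReal.ofReal l < 2 * f z then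
            ENNReal.ofReal (l ^ (q - 1 - 1)) else 0) =
            ENNReal.ofReal ((q-1)⁻¹) * (2 * f z) ^ (q-1) := by
          rw [h, ← mul_assoc, ← ENNReal.ofReal_mul (by positivity), inv_mul_cancel₀ hq1.ne']
          simp
        rw [h2, ENNReal.mul_rpow_of_nonneg _ _ hq1.le]
        have h3 : f z ^ q = f z * f z ^ (q-1) := by
          conv_lhs => rw [show q = 1 + (q-1) by ring]
          rw [ENNReal.rpow_add_of_nonneg _ _ (by norm_num) hq1.le, ENNReal.rpow_one]
        have h4 : (2:ℝ≥0∞) ^ (q-1) = ENNReal.ofReal (2 ^ (q-1)) := by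
          rw [← ENNReal.ofReal_rpow_of_nonneg (by norm_num) hq1.le]; simp
        rw [h3, h4]
        ring
    _ = _ := by
        rw [lintegral_const_mul' _ _ (ENNReal.mul_ne_top (by simp) (by simp)), ← mul_assoc,
          ← ENNReal.ofReal_mul (by positivity), ← ENNReal.ofReal_mul (by positivity),
          ← ENNReal.ofReal_mul (by positivity)]

/-- The potential: integral of the averages over all radii. -/
def JP (d : ℕ) (f : Pt d → ℝ≥0∞) (z : Pt d) : ℝ≥0∞ := ∫⁻ ρ in Ioi (0:ℝ), sAvg d ρ z f

lemma sAvg_le_rpow {d : ℕ} {q ρ : ℝ} (hq : 1 < q) (hρ : 0 < ρ) (z : Pt d) {f : Pt d → ℝ≥0∞}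
    (hf : Measurable f) : sAvg d ρ z f ≤ (sAvg d ρ z fun w => f w ^ q) ^ (1 / q) := by
  let V := volume (sCyl d ρ z)
  let ν : Measure (Pt d) := V⁻¹ • volume.restrict (sCyl d ρ z)
  have hν : IsProbabilityMeasure ν := by
    constructor
    simp only [ν, Measure.smul_apply, Measure.restrict_apply_univ, smul_eq_mul]
    exact ENNReal.inv_mul_cancel (vol_sCyl_ne_zero d hρ z) (vol_sCyl_ne_top d hρ z)
  have h := eLpNorm'_le_eLpNorm'_of_exponent_le (μ := ν) (f := f) one_pos hq.le
    hf.aestronglyMeasurable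
  simpa [eLpNorm', ν, lintegral_smul_measure, sAvg, V] using h

lemma tail_int {β a ε : ℝ} (hβ : 1 < β) (ha : 0 < a) (hε : 0 < ε) :
    ∫⁻ ρ in Ioi ε, ENNReal.ofReal (a * ρ ^ (-β)) = ENNReal.ofReal (a * ε ^ (1 - β) / (β - 1)) := by
  rw [← ofReal_integral_eq_lintegral_ofReal]
  · rw [integral_const_mul, integral_Ioi_rpow_of_lt (by linarith) hε]
    congr 1
    rw [show -β + 1 = -(β - 1) by ring, show 1 - β = -(β-1) by ring, neg_div_neg_eq, mul_div_assoc]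
  · exact (integrableOn_Ioi_rpow_of_lt (by linarith) hε).const_mul a
  · filter_upwards [ae_restrict_mem measurableSet_Ioi] with ρ hρ
    have : 0 < ρ := hε.trans hρ
    positivity

lemma hedberg {β a R : ℝ} (hβ : 1 < β) (ha : 0 < a) {h : ℝ → ℝ≥0∞} {m : ℝ≥0∞}
    (h1 : ∀ ρ, 0 < ρ → ρ ≤ R → h ρ ≤ m) (h2 : ∀ ρ, 0 < ρ → h ρ ≤ ENNReal.ofReal (a * ρ ^ (-β))) :
    ∫⁻ ρ in Ioc 0 R, h ρ ≤ ENNReal.ofReal (β / (β - 1) * a ^ (1 / β)) * m ^ (1 - 1 / β) := by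
  have hb : 0 < β - 1 := by linarith
  have hb0 : 0 < β := by linarith
  have hexp : 0 < 1 - 1 / β := by
    have : 1 / β < 1 := by rw [div_lt_one hb0]; exact hβ
    linarith
  rcases eq_or_ne m 0 with rfl | hm0
  · refine le_trans (setLIntegral_mono' (g := fun _ => 0) measurableSet_Ioc
      fun ρ hρ => h1 ρ hρ.1 hρ.2) ?_
    simp
  rcases eq_or_ne m ∞ with rfl | hmT
  · rw [ENNReal.top_rpow_of_pos hexp, ENNReal.mul_top]
    · exact le_top
    · have : 0 < β / (β - 1) * a ^ (1 / β) := by positivity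
      simpa using this
  obtain ⟨x, hx, rfl⟩ : ∃ x : ℝ, 0 < x ∧ ENNReal.ofReal x = m :=
    ⟨m.toReal, ENNReal.toReal_pos hm0 hmT, ENNReal.ofReal_toReal hmT⟩
  set ε := (a / x) ^ (1 / β) with hε
  have hε0 : 0 < ε := by positivity
  calc ∫⁻ ρ in Ioc 0 R, h ρ ≤ ∫⁻ ρ in (Ioc 0 R ∩ Iic ε) ∪ Ioi ε, h ρ := by
        refine lintegral_mono_set fun ρ hρ => ?_
        rcases le_or_gt ρ ε with h | h
        · exact Or.inl ⟨hρ, h⟩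
        · exact Or.inr h
    _ ≤ (∫⁻ ρ in Ioc 0 R ∩ Iic ε, h ρ) + ∫⁻ ρ in Ioi ε, h ρ := lintegral_union_le _ _ _
    _ ≤ (∫⁻ ρ in Ioc 0 R ∩ Iic ε, ENNReal.ofReal x) +
          ∫⁻ ρ in Ioi ε, ENNReal.ofReal (a * ρ ^ (-β)) := by
        refine add_le_add (setLIntegral_mono' (measurableSet_Ioc.inter measurableSet_Iic)
          fun ρ hρ => h1 ρ hρ.1.1 hρ.1.2) (setLIntegral_mono' measurableSet_Ioi
          fun ρ hρ => h2 ρ (hε0.trans hρ))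
    _ ≤ ENNReal.ofReal x * ENNReal.ofReal ε + ENNReal.ofReal (a * ε ^ (1 - β) / (β - 1)) := by
        rw [tail_int hβ ha hε0, setLIntegral_const]
        gcongr
        refine (measure_mono (t := Ioc 0 ε) fun ρ hρ => ⟨hρ.1.1, hρ.2⟩).trans ?_
        simp
    _ = _ := by
        rw [ENNReal.ofReal_rpow_of_pos hx, ← ENNReal.ofReal_mul (by positivity),
          ← ENNReal.ofReal_mul (by positivity), ← ENNReal.ofReal_add (by positivity)
          (by positivity)]
        congr 1
        have e1 : x * ε = a ^ (1 / β) * x ^ (1 - 1 / β) := by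
          rw [hε, Real.div_rpow ha.le hx.le, Real.rpow_sub hx, Real.rpow_one]; ring
        have e2 : a * ε ^ (1 - β) = a ^ (1 / β) * x ^ (1 - 1 / β) := by
          have : ε ^ (1 - β) = ε * (a / x)⁻¹ := by
            rw [Real.rpow_sub hε0, Real.rpow_one]
            congr 1
            rw [hε, ← Real.rpow_mul (by positivity), one_div, inv_mul_cancel₀ hb0.ne',
              Real.rpow_one]
          rw [this, ← e1]
          field_simp
        rw [e1, e2]
        field_simp
        ring

lemma sAvg_const_mul {d : ℕ} {ρ : ℝ} (z : Pt d) (c : ℝ≥0∞) (f : Pt d → ℝ≥0∞)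
    (hc : c ≠ ∞) : sAvg d ρ z (fun w => c * f w) = c * sAvg d ρ z f := by
  unfold sAvg
  rw [lintegral_const_mul' _ _ hc]
  ring

lemma sAvg_add_const {d : ℕ} {ρ : ℝ} (hρ : 0 < ρ) (z : Pt d) (c : ℝ≥0∞) (f : Pt d → ℝ≥0∞) :
    sAvg d ρ z (fun w => f w + c) = sAvg d ρ z f + c := by
  unfold sAvg
  rw [lintegral_add_right _ measurable_const, mul_add, setLIntegral_const]
  congr 1
  rw [mul_comm, mul_assoc, ENNReal.mul_inv_cancel (vol_sCyl_ne_zero d hρ z)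
    (vol_sCyl_ne_top d hρ z), mul_one]

lemma sCyl_sub {d : ℕ} {ρ R : ℝ} {z z0 : Pt d} (hρ : 0 < ρ) (hR : ρ ≤ R) (hz : z ∈ sCyl d R z0) :
    sCyl d ρ z ⊆ sCyl d (2 * R) z0 := by
  intro w hw
  simp only [sCyl, mem_prod, Metric.mem_ball] at *
  constructor
  · have := dist_triangle w.1 z.1 z0.1
    nlinarith [hw.1, hz.1]
  · have := dist_triangle w.2 z.2 z0.2
    linarith [hw.2, hz.2]

lemma morrey_pot (d : ℕ) {q β r : ℝ} (hq : 1 < q) (hβ : 1 < β) (hr : r * (β - 1) = q * β) :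
    ∃ N : ℝ, 0 < N ∧ ∀ (G : Pt d → ℝ≥0∞) (a : ℝ), Measurable G → 0 < a →
      (∀ (ρ : ℝ) (z : Pt d), 0 < ρ → sAvg d ρ z (fun w => G w ^ q) ≤
        ENNReal.ofReal ((a * ρ ^ (-β)) ^ q)) →
      ∀ (R : ℝ) (z0 : Pt d), 0 < R → sAvg d R z0 (fun z => JP d G z ^ r) ≤
        ENNReal.ofReal (N * (a * R ^ (1 - β)) ^ r) := by
  obtain ⟨C, hC, hstrong⟩ := strong_type d hq
  have hb : 0 < β - 1 := by linarith
  have hb0 : 0 < β := by linarith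
  have hr' : r = q * β / (β - 1) := by field_simp; linarith
  have hr1 : 1 < r := by rw [hr', lt_div_iff₀ hb]; nlinarith
  refine ⟨2 ^ (r - 1) * ((β / (β - 1)) ^ r * (C * 2 ^ (d + 2) * 2 ^ (-β * q)) +
    (1 / (β - 1)) ^ r), by positivity, ?_⟩
  intro G a hG ha hM R z0 hR
  have h1 : ∀ (ρ : ℝ) (z : Pt d), 0 < ρ → sAvg d ρ z G ≤ ENNReal.ofReal (a * ρ ^ (-β)) := by
    intro ρ z hρ
    refine (sAvg_le_rpow hq hρ z hG).trans ?_
    refine (ENNReal.rpow_le_rpow (hM ρ z hρ) (by positivity)).trans_eq ?_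
    rw [ENNReal.ofReal_rpow_of_pos (by positivity), ← Real.rpow_mul (by positivity),
      mul_one_div_cancel (by linarith), Real.rpow_one]
  let G1 := (sCyl d (2 * R) z0).indicator G
  have hG1 : Measurable G1 := hG.indicator (measurableSet_sCyl _ _ _)
  have hpt : ∀ z ∈ sCyl d R z0, JP d G z ^ r ≤
      ENNReal.ofReal (2 ^ (r-1) * (β / (β - 1)) ^ r * a ^ (r / β)) * sMax d G1 z ^ q +
        ENNReal.ofReal (2 ^ (r-1) * (1 / (β - 1)) ^ r * (a * R ^ (1 - β)) ^ r) := by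
    intro z hz
    have near := hedberg (R := R) hβ ha (h := fun ρ => sAvg d ρ z G) (m := sMax d G1 z)
      (fun ρ h0 hle => by
        refine le_trans (sAvg_mono (g := G1) fun w hw => ?_) ?_
        · simp only [G1]
          rw [indicator_of_mem (sCyl_sub h0 hle hz hw)]
        · unfold sMax
          exact le_iSup_of_le ρ (le_iSup_of_le h0 (le_iSup_of_le z
            (le_iSup_of_le (self_mem_sCyl d h0 z) le_rfl))))
      (fun ρ h0 => h1 ρ z h0)
    have far : ∫⁻ ρ in Ioi R, sAvg d ρ z G ≤ ENNReal.ofReal (a * R ^ (1 - β) / (β - 1)) := by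
      rw [← tail_int hβ ha hR]
      exact setLIntegral_mono' measurableSet_Ioi fun ρ hρ => h1 ρ z (hR.trans hρ)
    have hJ : JP d G z ≤ ENNReal.ofReal (β / (β - 1) * a ^ (1 / β)) * sMax d G1 z ^ (1 - 1 / β) +
        ENNReal.ofReal (a * R ^ (1 - β) / (β - 1)) := by
      unfold JP
      rw [← Ioc_union_Ioi_eq_Ioi hR.le]
      exact (lintegral_union_le _ _ _).trans (add_le_add near far)
    refine (ENNReal.rpow_le_rpow hJ (by linarith)).trans ?_
    refine (ENNReal.rpow_add_le_mul_rpow_add_rpow _ _ hr1.le).trans_eq ?_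
    rw [mul_add, ENNReal.mul_rpow_of_nonneg _ _ (by linarith), ← ENNReal.rpow_mul,
      show (1 - 1 / β) * r = q by field_simp; linarith,
      ENNReal.ofReal_rpow_of_pos (by positivity), ENNReal.ofReal_rpow_of_pos (by positivity),
      show (2:ℝ≥0∞) ^ (r-1) = ENNReal.ofReal (2 ^ (r-1)) by
        rw [← ENNReal.ofReal_rpow_of_pos (by norm_num)]; simp,
      ← mul_assoc, ← ENNReal.ofReal_mul (by positivity), ← ENNReal.ofReal_mul (by positivity)]
    congr 1
    · congr 2
      rw [Real.mul_rpow (by positivity) (by positivity), ← Real.rpow_mul ha.le]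
      rw [show 1 / β * r = r / β by ring]; ring
    · congr 1
      rw [div_eq_mul_one_div (a * R ^ (1 - β)), Real.mul_rpow (by positivity) (by positivity)]
      ring
  refine (sAvg_mono hpt).trans ?_
  rw [sAvg_add_const hR, sAvg_const_mul _ _ _ (by simp)]
  have hMq : sAvg d R z0 (fun w => sMax d G1 w ^ q) ≤
      ENNReal.ofReal (C * 2 ^ (d+2) * (a * (2 * R) ^ (-β)) ^ q) := by
    have e1 : ∫⁻ w, G1 w ^ q = ∫⁻ w in sCyl d (2 * R) z0, G w ^ q := by
      rw [← lintegral_indicator (measurableSet_sCyl _ _ _)]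
      congr with w
      by_cases hw : w ∈ sCyl d (2 * R) z0
      · simp [G1, hw]
      · simp [G1, hw, (by linarith : 0 < q)]
    have e2 := hM (2 * R) z0 (by positivity)
    have e3 := vol_sCyl_scale d (c := 2) (by norm_num) hR z0 z0
    have e4 : (volume (sCyl d R z0))⁻¹ = ENNReal.ofReal (2 ^ (d+2)) *
        (volume (sCyl d (2 * R) z0))⁻¹ := by
      rw [e3, ENNReal.mul_inv (Or.inr (vol_sCyl_ne_top d hR _)) (Or.inl (by simp)), ← mul_assoc,
        ENNReal.mul_inv_cancel (by simp) (by simp), one_mul]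
    calc sAvg d R z0 (fun w => sMax d G1 w ^ q)
        ≤ (volume (sCyl d R z0))⁻¹ * ∫⁻ w, sMax d G1 w ^ q :=
          mul_le_mul_right (setLIntegral_le_lintegral _ _) _
      _ ≤ (volume (sCyl d R z0))⁻¹ * (ENNReal.ofReal C * ∫⁻ w, G1 w ^ q) :=
          mul_le_mul_right (hstrong G1 hG1) _
      _ = ENNReal.ofReal (C * 2 ^ (d+2)) * sAvg d (2 * R) z0 (fun w => G w ^ q) := by
          rw [e1, e4, ENNReal.ofReal_mul hC.le, sAvg]; ring
      _ ≤ ENNReal.ofReal (C * 2 ^ (d+2)) * ENNReal.ofReal ((a * (2 * R) ^ (-β)) ^ q) :=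
          mul_le_mul_right e2 _
      _ = _ := by rw [← ENNReal.ofReal_mul (by positivity)]
  refine (add_le_add_left (mul_le_mul_right hMq _) _).trans_eq ?_
  rw [← ENNReal.ofReal_mul (by positivity), ← ENNReal.ofReal_add (by positivity) (by positivity)]
  congr 1
  have k1 : (a * (2 * R) ^ (-β)) ^ q = a ^ q * 2 ^ (-β * q) * R ^ (-β * q) := by
    rw [Real.mul_rpow (by positivity) (by positivity), ← Real.rpow_mul (by positivity),
      Real.mul_rpow (by positivity) (by positivity)]
    ring
  have k2 : (a * R ^ (1 - β)) ^ r = a ^ (r / β) * a ^ q * R ^ (-β * q) := by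
    rw [Real.mul_rpow (by positivity) (by positivity), ← Real.rpow_mul (by positivity),
      ← Real.rpow_add ha]
    congr 2
    · field_simp; linarith
    · linarith
  rw [k1, k2]
  ring

lemma fderiv_eq_of_line {d : ℕ} {f : Pt d → ℝ} {w v : Pt d} {c : ℝ} (hf : DifferentiableAt ℝ f w)
    (h : HasDerivAt (fun s : ℝ => f (w + s • v)) c 0) : fderiv ℝ f w v = c := by
  have h1 : HasLineDerivAt ℝ f c w v := h
  exact (hf.hasFDerivAt.hasLineDerivAt v).unique h1

/-- base profile -/
def profX (s : ℝ) : ℝ := Real.smoothTransition (4 * s - 1) - 1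

lemma profX_contDiff : ContDiff ℝ (⊤ : ℕ∞) profX := by
  unfold profX
  exact (Real.smoothTransition.contDiff.comp (by fun_prop)).sub contDiff_const

lemma profX_zero {s : ℝ} (hs : 1 / 2 ≤ s) : profX s = 0 := by
  unfold profX
  rw [Real.smoothTransition.one_of_one_le (by linarith)]; ring

lemma profX_mono : Monotone profX := by
  intro a b hab
  unfold profX
  have := Real.smoothTransition.monotone (show 4 * a - 1 ≤ 4 * b - 1 by linarith)
  linarith

lemma profX_deriv_zero {s : ℝ} (hs : 1 / 2 < s) : deriv profX s = 0 := by
  have : profX =ᶠ[nhds s] fun _ => 0 := by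
    filter_upwards [lt_mem_nhds hs] with y hy
    exact profX_zero hy.le
  rw [this.deriv_eq]; simp

lemma profX_deriv_ne : ∃ s : ℝ, 0 < s ∧ deriv profX s ≠ 0 := by
  obtain ⟨c, hc, h⟩ := exists_deriv_eq_slope profX (show (1/4:ℝ) < 1/2 by norm_num)
    profX_contDiff.continuous.continuousOn
    (profX_contDiff.differentiable (by simp)).differentiableOn
  refine ⟨c, by linarith [hc.1], ?_⟩
  rw [h, profX_zero le_rfl]
  simp only [profX]
  rw [Real.smoothTransition.zero_of_nonpos (by norm_num)]
  norm_num

lemma profX_deriv_contDiff : ContDiff ℝ (⊤ : ℕ∞) (deriv profX) :=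
  (contDiff_infty_iff_deriv.1 profX_contDiff).2

/-- time bump -/
def timeBump : ContDiffBump (1 / 2 : ℝ) := ⟨1 / 8, 1 / 4, by norm_num, by norm_num⟩

lemma bump_exists (d : ℕ) (hd : 1 ≤ d) : ∃ B φ : Pt d → ℝ, ContDiff ℝ (⊤ : ℕ∞) B ∧
    ContDiff ℝ (⊤ : ℕ∞) φ ∧ HasCompactSupport B ∧ HasCompactSupport φ ∧
    tsupport B ⊆ Ioo (0:ℝ) 1 ×ˢ Metric.ball (0 : Ed d) 1 ∧
    tsupport φ ⊆ Ioo (0:ℝ) 1 ×ˢ Metric.ball (0 : Ed d) 1 ∧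
    (∀ j w, spDeriv d j B w = w.2 j * φ w) ∧ ∫ w, φ w = 1 := by
  let B0 : Pt d → ℝ := fun w => (1 / 2) * timeBump w.1 * profX (‖w.2‖ ^ 2)
  let φ0 : Pt d → ℝ := fun w => timeBump w.1 * deriv profX (‖w.2‖ ^ 2)
  have hbump : ContDiff ℝ (⊤ : ℕ∞) fun w : Pt d => timeBump w.1 :=
    timeBump.contDiff.comp contDiff_fst
  have hnsq : ContDiff ℝ (⊤ : ℕ∞) fun w : Pt d => ‖w.2‖ ^ 2 := contDiff_snd.norm_sq ℝ
  have hB0 : ContDiff ℝ (⊤ : ℕ∞) B0 :=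
    (contDiff_const.mul hbump).mul (profX_contDiff.comp hnsq)
  have hφ0 : ContDiff ℝ (⊤ : ℕ∞) φ0 := hbump.mul (profX_deriv_contDiff.comp hnsq)
  let K : Set (Pt d) := Metric.closedBall (1/2 : ℝ) (1/4) ×ˢ Metric.closedBall (0 : Ed d) (3/4)
  have hK : IsCompact K := (isCompact_closedBall _ _).prod (isCompact_closedBall _ _)
  have hKU : K ⊆ Ioo (0:ℝ) 1 ×ˢ Metric.ball (0 : Ed d) 1 := by
    rintro ⟨t, x⟩ ⟨h1, h2⟩
    simp only [Metric.mem_closedBall, Real.dist_eq, abs_le] at h1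
    refine ⟨⟨by linarith [h1.1], by linarith [h1.2]⟩, ?_⟩
    exact Metric.closedBall_subset_ball (by norm_num) h2
  have hz : ∀ w ∉ K, timeBump w.1 = 0 ∨ 1 / 2 < ‖w.2‖ ^ 2 := by
    intro w hw
    by_cases h1 : w.1 ∈ Metric.closedBall (1/2 : ℝ) (1/4)
    · right
      have h2 : w.2 ∉ Metric.closedBall (0 : Ed d) (3/4) := fun h => hw ⟨h1, h⟩
      simp only [Metric.mem_closedBall, dist_zero_right, not_le] at h2
      nlinarith
    · left
      refine timeBump.zero_of_le_dist ?_
      simp only [Metric.mem_closedBall, not_le] at h1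
      exact h1.le
  have sB : tsupport B0 ⊆ K := by
    refine closure_minimal (fun w hw => ?_) hK.isClosed
    by_contra hwK
    refine hw ?_
    rcases hz w hwK with h | h
    · simp [B0, h]
    · simp [B0, profX_zero h.le]
  have sφ : tsupport φ0 ⊆ K := by
    refine closure_minimal (fun w hw => ?_) hK.isClosed
    by_contra hwK
    refine hw ?_
    rcases hz w hwK with h | h
    · simp [φ0, h]
    · simp [φ0, profX_deriv_zero h]
  have cB : HasCompactSupport B0 := hK.of_isClosed_subset (isClosed_tsupport _) sB
  have cφ : HasCompactSupport φ0 := hK.of_isClosed_subset (isClosed_tsupport _) sφ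
  have hrel : ∀ j w, spDeriv d j B0 w = w.2 j * φ0 w := by
    intro j w
    refine fderiv_eq_of_line (hB0.differentiable (by simp) w) ?_
    have h1 : HasDerivAt (fun s : ℝ => w.2 + s • EuclideanSpace.single j (1:ℝ))
        (EuclideanSpace.single j (1:ℝ)) 0 := by
      simpa using ((hasDerivAt_id (0:ℝ)).smul_const (EuclideanSpace.single j (1:ℝ))).const_add w.2
    have h2 := h1.norm_sq
    have h3 : HasDerivAt profX (deriv profX (‖w.2‖ ^ 2))
        (‖w.2 + (0:ℝ) • EuclideanSpace.single j (1:ℝ)‖ ^ 2) := by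
      simpa using (profX_contDiff.differentiable (by simp) (‖w.2‖^2)).hasDerivAt
    have h4 := (h3.comp (0:ℝ) h2).const_mul ((1 / 2) * timeBump w.1)
    simp only [B0, φ0]
    refine (h4.congr_deriv ?_).congr_of_eventuallyEq (Eventually.of_forall fun s => ?_)
    · have hin : inner ℝ (w.2 + (0:ℝ) • EuclideanSpace.single j (1:ℝ))
          (EuclideanSpace.single j (1:ℝ)) = w.2 j := by
        rw [zero_smul, add_zero, EuclideanSpace.inner_single_right]; simp
      rw [hin]
      ring
    · simp
  have hnn : ∀ w, 0 ≤ φ0 w := fun w => mul_nonneg timeBump.nonneg (profX_mono.deriv_nonneg)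
  have hpos : 0 < ∫ w, φ0 w := by
    obtain ⟨s, hs, hs'⟩ := profX_deriv_ne
    refine hφ0.continuous.integral_pos_of_hasCompactSupport_nonneg_nonzero cφ hnn
      (x := (1/2, EuclideanSpace.single ⟨0, hd⟩ (Real.sqrt s))) ?_
    simp only [φ0, PiLp.norm_single, Real.norm_eq_abs, sq_abs]
    rw [Real.sq_sqrt hs.le]
    refine mul_ne_zero ?_ hs'
    exact (timeBump.pos_of_mem_ball (by simp [timeBump])).ne'
  let c := (∫ w, φ0 w)⁻¹
  refine ⟨fun w => c * B0 w, fun w => c * φ0 w, contDiff_const.mul hB0, contDiff_const.mul hφ0,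
    cB.mul_left, cφ.mul_left, ?_, ?_, ?_, ?_⟩
  · exact (tsupport_mul_subset_right (f := fun _ => c) (g := B0)).trans (sB.trans hKU)
  · exact (tsupport_mul_subset_right (f := fun _ => c) (g := φ0)).trans (sφ.trans hKU)
  · intro j w
    have := hrel j w
    unfold spDeriv at this ⊢
    rw [fderiv_const_mul (hB0.differentiable (by simp) w)]
    simp only [_root_.smul_apply, smul_eq_mul, this]
    ring
  · rw [integral_const_mul]
    exact inv_mul_cancel₀ hpos.ne'

lemma cd_dir {d : ℕ} {f : Pt d → ℝ} (hf : ContDiff ℝ (⊤ : ℕ∞) f) (v : Pt d) :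
    ContDiff ℝ (⊤ : ℕ∞) (fun z => fderiv ℝ f z v) :=
  (hf.fderiv_right (m := (⊤ : ℕ∞)) (by simp)).clm_apply contDiff_const

lemma cd_sp {d : ℕ} {f : Pt d → ℝ} (hf : ContDiff ℝ (⊤ : ℕ∞) f) (i : Fin d) :
    ContDiff ℝ (⊤ : ℕ∞) (spDeriv d i f) := cd_dir hf _

lemma cd_time {d : ℕ} {f : Pt d → ℝ} (hf : ContDiff ℝ (⊤ : ℕ∞) f) :
    ContDiff ℝ (⊤ : ℕ∞) (timeDeriv d f) := cd_dir hf _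

lemma cd_lap {d : ℕ} {f : Pt d → ℝ} (hf : ContDiff ℝ (⊤ : ℕ∞) f) :
    ContDiff ℝ (⊤ : ℕ∞) (lap d f) := by
  unfold lap
  exact ContDiff.sum fun i _ => cd_sp (cd_sp hf i) i

lemma dir_comm {d : ℕ} {f : Pt d → ℝ} (hf : ContDiff ℝ (⊤ : ℕ∞) f) (v w z : Pt d) :
    fderiv ℝ (fun y => fderiv ℝ f y v) z w = fderiv ℝ (fun y => fderiv ℝ f y w) z v := by
  have hs : IsSymmSndFDerivAt ℝ f z := (hf.contDiffAt (x := z)).isSymmSndFDerivAt (by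
    simp only [minSmoothness_of_isRCLikeNormedField]
    exact WithTop.coe_le_coe.2 (le_top : (2 : ℕ∞) ≤ ⊤))
  have hd : DifferentiableAt ℝ (fderiv ℝ f) z :=
    (hf.fderiv_right (m := (⊤ : ℕ∞)) (by simp)).differentiable (by simp) z
  have h := hs v w
  rw [fderiv_clm_apply hd (differentiableAt_const _), fderiv_clm_apply hd (differentiableAt_const _)]
  simpa using h.symm

lemma sp_sp_comm {d : ℕ} {f : Pt d → ℝ} (hf : ContDiff ℝ (⊤ : ℕ∞) f) (i j : Fin d) :
    spDeriv d i (spDeriv d j f) = spDeriv d j (spDeriv d i f) := by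
  ext z; exact dir_comm hf _ _ z

lemma time_sp_comm {d : ℕ} {f : Pt d → ℝ} (hf : ContDiff ℝ (⊤ : ℕ∞) f) (i : Fin d) :
    timeDeriv d (spDeriv d i f) = spDeriv d i (timeDeriv d f) := by
  ext z; exact dir_comm hf _ _ z

lemma lap_sp_comm {d : ℕ} {f : Pt d → ℝ} (hf : ContDiff ℝ (⊤ : ℕ∞) f) (i : Fin d) (z : Pt d) :
    ∑ j, spDeriv d j (spDeriv d j (spDeriv d i f)) z = spDeriv d i (lap d f) z := by
  have h1 : ∀ j, spDeriv d j (spDeriv d j (spDeriv d i f)) =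
      spDeriv d i (spDeriv d j (spDeriv d j f)) := by
    intro j
    rw [sp_sp_comm hf j i, sp_sp_comm (cd_sp hf j) j i]
  have h2 : lap d f = fun z => ∑ j, spDeriv d j (spDeriv d j f) z := rfl
  rw [h2]
  change _ = fderiv ℝ (fun z => ∑ j, spDeriv d j (spDeriv d j f) z) z
    ((0 : ℝ), EuclideanSpace.single i (1 : ℝ))
  rw [fderiv_fun_sum fun j _ => (cd_sp (cd_sp hf j) j).differentiable (by simp) z]
  simp only [h1, _root_.sum_apply]
  rfl

/-- parabolic dilation -/
def pA (d : ℕ) (σ ρ : ℝ) (z w : Pt d) : Pt d := (z.1 + σ * ρ ^ 2 * w.1, z.2 + ρ • w.2)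

lemma pA_cd (d : ℕ) (σ ρ : ℝ) (z : Pt d) : ContDiff ℝ (⊤ : ℕ∞) (pA d σ ρ z) := by
  unfold pA; fun_prop

lemma pA_cont (d : ℕ) (σ : ℝ) (z : Pt d) :
    Continuous fun p : ℝ × Pt d => pA d σ p.1 z p.2 := by
  unfold pA; fun_prop

lemma sp_comp {d : ℕ} {f : Pt d → ℝ} (hf : ContDiff ℝ (⊤ : ℕ∞) f) (σ ρ : ℝ) (z w : Pt d)
    (i : Fin d) : spDeriv d i (fun w => f (pA d σ ρ z w)) w = ρ * spDeriv d i f (pA d σ ρ z w) := by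
  refine fderiv_eq_of_line ((hf.comp (pA_cd d σ ρ z)).differentiable (by simp) w) ?_
  have h1 : HasFDerivAt f (fderiv ℝ f (pA d σ ρ z w)) (pA d σ ρ z w) :=
    (hf.differentiable (by simp) _).hasFDerivAt
  have h2 := (h1.hasLineDerivAt (ρ • ((0:ℝ), EuclideanSpace.single i (1:ℝ))))
  unfold HasLineDerivAt at h2
  rw [map_smul, smul_eq_mul] at h2
  refine h2.congr_of_eventuallyEq (Eventually.of_forall fun s => ?_)
  simp only [pA]
  congr 1
  ext1
  · simp
  · simp [add_assoc, smul_smul, mul_comm]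

lemma deriv_rho {d : ℕ} {f : Pt d → ℝ} (hf : ContDiff ℝ (⊤ : ℕ∞) f) (σ ρ : ℝ) (z w : Pt d) :
    HasDerivAt (fun ρ => f (pA d σ ρ z w)) (2 * σ * ρ * w.1 * timeDeriv d f (pA d σ ρ z w) +
      ∑ j, w.2 j * spDeriv d j f (pA d σ ρ z w)) ρ := by
  have h1 : HasFDerivAt f (fderiv ℝ f (pA d σ ρ z w)) (pA d σ ρ z w) :=
    (hf.differentiable (by simp) _).hasFDerivAt
  have h2 : HasDerivAt (fun ρ => pA d σ ρ z w) (2 * σ * ρ * w.1, w.2) ρ := by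
    unfold pA
    refine HasDerivAt.prodMk ?_ ?_
    · have := ((((hasDerivAt_id ρ).pow 2).const_mul σ).mul_const w.1).const_add z.1
      refine this.congr_deriv ?_
      simp only [id, Nat.cast_ofNat, mul_one, Nat.add_one_sub_one, pow_one]; ring
    · simpa using ((hasDerivAt_id ρ).smul_const w.2).const_add z.2
  refine (h1.comp_hasDerivAt ρ h2).congr_deriv ?_
  have e : ((2 * σ * ρ * w.1, w.2) : Pt d) = (2 * σ * ρ * w.1) • ((1:ℝ), (0 : Ed d)) +
      ∑ j, w.2 j • ((0:ℝ), EuclideanSpace.single j (1:ℝ)) := by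
    ext1
    · simp [Prod.fst_sum]
    · simp only [Prod.snd_add, Prod.smul_snd, smul_zero, zero_add, Prod.snd_sum]
      ext k
      simp [Pi.single_apply]
  rw [e, map_add, map_smul, map_sum]
  simp only [map_smul, smul_eq_mul]
  rfl

lemma ibp {d : ℕ} {φ h : Pt d → ℝ} (hφ : ContDiff ℝ (⊤ : ℕ∞) φ) (cφ : HasCompactSupport φ)
    (hh : ContDiff ℝ (⊤ : ℕ∞) h) (i : Fin d) :
    ∫ w, φ w * spDeriv d i h w = - ∫ w, spDeriv d i φ w * h w := by
  have c1 : HasCompactSupport (spDeriv d i φ) := cφ.fderiv_apply (𝕜 := ℝ) _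
  have : (volume : Measure (Pt d)).IsAddHaarMeasure := by
    rw [Measure.volume_eq_prod]; infer_instance
  refine integral_mul_fderiv_eq_neg_fderiv_mul_of_integrable (μ := (volume : Measure (Pt d))) ?_ ?_ ?_ ?_ ?_
  · exact ((cd_sp hφ i).continuous.mul hh.continuous).integrable_of_hasCompactSupport c1.mul_right
  · exact (hφ.continuous.mul (cd_sp hh i).continuous).integrable_of_hasCompactSupport cφ.mul_right
  · exact (hφ.continuous.mul hh.continuous).integrable_of_hasCompactSupport cφ.mul_right
  · exact fun x _ => hφ.differentiable (by simp) x
  · exact fun x _ => hh.differentiable (by simp) x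

/-- inner identity -/
lemma inner_id {d : ℕ} {B φ u : Pt d → ℝ} (hB : ContDiff ℝ (⊤ : ℕ∞) B)
    (hφ : ContDiff ℝ (⊤ : ℕ∞) φ) (cB : HasCompactSupport B) (cφ : HasCompactSupport φ)
    (hrel : ∀ j w, spDeriv d j B w = w.2 j * φ w) (hu : ContDiff ℝ (⊤ : ℕ∞) u)
    (i : Fin d) (σ ρ : ℝ) (z : Pt d) :
    ∫ w, φ w * (2 * σ * ρ * w.1 * timeDeriv d (spDeriv d i u) (pA d σ ρ z w) +
      ∑ j, w.2 j * spDeriv d j (spDeriv d i u) (pA d σ ρ z w)) =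
    ∫ w, (-(2 * σ) * spDeriv d i (fun w => w.1 * φ w) w * timeDeriv d u (pA d σ ρ z w) +
      spDeriv d i B w * lap d u (pA d σ ρ z w)) := by
  have hA := pA_cd d σ ρ z
  have hψ : ContDiff ℝ (⊤ : ℕ∞) (fun w : Pt d => w.1 * φ w) := contDiff_fst.mul hφ
  have cψ : HasCompactSupport (fun w : Pt d => w.1 * φ w) := cφ.mul_left
  have hut := (cd_time hu).comp hA
  have hul := (cd_lap hu).comp hA
  have i1 := ibp hψ cψ hut i
  have i2 : ∀ j, _ := fun j => ibp hB cB ((cd_sp (cd_sp hu i) j).comp hA) j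
  have i3 := ibp hB cB hul i
  have s1 : ∀ w, spDeriv d i (timeDeriv d u ∘ pA d σ ρ z) w =
      ρ * spDeriv d i (timeDeriv d u) (pA d σ ρ z w) := fun w => sp_comp (cd_time hu) σ ρ z w i
  have s2 : ∀ j w, spDeriv d j (spDeriv d j (spDeriv d i u) ∘ pA d σ ρ z) w =
      ρ * spDeriv d j (spDeriv d j (spDeriv d i u)) (pA d σ ρ z w) :=
    fun j w => sp_comp (cd_sp (cd_sp hu i) j) σ ρ z w j
  have s3 : ∀ w, spDeriv d i (lap d u ∘ pA d σ ρ z) w =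
      ρ * spDeriv d i (lap d u) (pA d σ ρ z w) := fun w => sp_comp (cd_lap hu) σ ρ z w i
  have cdB : ∀ j, HasCompactSupport (spDeriv d j B) := fun j => cB.fderiv_apply (𝕜 := ℝ) _
  have cdψ : HasCompactSupport (spDeriv d i (fun w : Pt d => w.1 * φ w)) :=
    cψ.fderiv_apply (𝕜 := ℝ) _
  have int1 : Integrable (fun w : Pt d => (w.1 * φ w) *
      spDeriv d i (timeDeriv d u ∘ pA d σ ρ z) w) :=
    (hψ.continuous.mul (cd_sp hut i).continuous).integrable_of_hasCompactSupport cψ.mul_right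
  have int2 : ∀ j, Integrable (fun w : Pt d => spDeriv d j B w *
      (spDeriv d j (spDeriv d i u) ∘ pA d σ ρ z) w) := fun j =>
    ((cd_sp hB j).continuous.mul ((cd_sp (cd_sp hu i) j).comp hA).continuous
      ).integrable_of_hasCompactSupport (cdB j).mul_right
  have int3 : ∀ j, Integrable (fun w : Pt d => B w *
      spDeriv d j (spDeriv d j (spDeriv d i u) ∘ pA d σ ρ z) w) := fun j =>
    (hB.continuous.mul (cd_sp ((cd_sp (cd_sp hu i) j).comp hA) j).continuous
      ).integrable_of_hasCompactSupport cB.mul_right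
  have int4 : Integrable (fun w : Pt d => spDeriv d i (fun w => w.1 * φ w) w *
      (timeDeriv d u ∘ pA d σ ρ z) w) :=
    ((cd_sp hψ i).continuous.mul hut.continuous).integrable_of_hasCompactSupport cdψ.mul_right
  have int5 : Integrable (fun w : Pt d => spDeriv d i B w * (lap d u ∘ pA d σ ρ z) w) :=
    ((cd_sp hB i).continuous.mul hul.continuous).integrable_of_hasCompactSupport (cdB i).mul_right
  calc _ = ∫ w, (2 * σ * ((w.1 * φ w) * spDeriv d i (timeDeriv d u ∘ pA d σ ρ z) w) +
        ∑ j, spDeriv d j B w * (spDeriv d j (spDeriv d i u) ∘ pA d σ ρ z) w) := by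
        congr with w
        rw [s1, time_sp_comm hu, mul_add, Finset.mul_sum]
        congr 1
        · ring
        · refine Finset.sum_congr rfl fun j _ => ?_
          rw [hrel, Function.comp_apply]; ring
    _ = 2 * σ * (∫ w, (w.1 * φ w) * spDeriv d i (timeDeriv d u ∘ pA d σ ρ z) w) +
        ∑ j, ∫ w, spDeriv d j B w * (spDeriv d j (spDeriv d i u) ∘ pA d σ ρ z) w := by
        rw [integral_add (int1.const_mul _) (integrable_finsetSum _ fun j _ => int2 j),
          integral_const_mul, integral_finsetSum _ fun j _ => int2 j]
    _ = 2 * σ * (- ∫ w, spDeriv d i (fun w => w.1 * φ w) w * (timeDeriv d u ∘ pA d σ ρ z) w) -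
        ∑ j, ∫ w, B w * spDeriv d j (spDeriv d j (spDeriv d i u) ∘ pA d σ ρ z) w := by
        rw [i1, sub_eq_add_neg, ← Finset.sum_neg_distrib]
        congr 1
        refine Finset.sum_congr rfl fun j _ => ?_
        rw [i2 j, neg_neg]
    _ = 2 * σ * (- ∫ w, spDeriv d i (fun w => w.1 * φ w) w * (timeDeriv d u ∘ pA d σ ρ z) w) -
        ∫ w, B w * spDeriv d i (lap d u ∘ pA d σ ρ z) w := by
        rw [← integral_finsetSum _ fun j _ => int3 j]
        congr 2
        ext w
        rw [← Finset.mul_sum, s3]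
        simp_rw [s2]
        rw [← Finset.mul_sum, lap_sp_comm hu]
    _ = 2 * σ * (- ∫ w, spDeriv d i (fun w => w.1 * φ w) w * (timeDeriv d u ∘ pA d σ ρ z) w) +
        ∫ w, spDeriv d i B w * (lap d u ∘ pA d σ ρ z) w := by
        rw [i3]; ring
    _ = ∫ w, (-(2 * σ) * (spDeriv d i (fun w => w.1 * φ w) w * (timeDeriv d u ∘ pA d σ ρ z) w) +
          spDeriv d i B w * (lap d u ∘ pA d σ ρ z) w) := by
        rw [integral_add (int4.const_mul _) int5, integral_const_mul]; ring
    _ = _ := by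
        congr with w
        simp only [Function.comp_apply]; ring

lemma rep_id {d : ℕ} {B φ u : Pt d → ℝ} (hB : ContDiff ℝ (⊤ : ℕ∞) B)
    (hφ : ContDiff ℝ (⊤ : ℕ∞) φ) (cB : HasCompactSupport B) (cφ : HasCompactSupport φ)
    (hrel : ∀ j w, spDeriv d j B w = w.2 j * φ w) (hmass : ∫ w, φ w = 1)
    (hu : ContDiff ℝ (⊤ : ℕ∞) u) (i : Fin d) (σ R : ℝ) (hR : 0 < R) (z : Pt d) :
    spDeriv d i u z = - (R⁻¹ * ∫ w, spDeriv d i φ w * u (pA d σ R z w)) -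
      ∫ ρ in Ioc 0 R,
        ∫ w, (-(2 * σ) * spDeriv d i (fun w => w.1 * φ w) w * timeDeriv d u (pA d σ ρ z w) +
          spDeriv d i B w * lap d u (pA d σ ρ z w)) := by
  have hA := pA_cd d σ R z
  have hv := cd_sp hu i
  let g : ℝ → Pt d → ℝ := fun ρ w =>
    φ w * (2 * σ * ρ * w.1 * timeDeriv d (spDeriv d i u) (pA d σ ρ z w) +
      ∑ j, w.2 j * spDeriv d j (spDeriv d i u) (pA d σ ρ z w))
  have c1 : Continuous fun p : ℝ × Pt d => timeDeriv d (spDeriv d i u) (pA d σ p.1 z p.2) :=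
    (cd_time hv).continuous.comp (pA_cont d σ z)
  have c2 : ∀ j, Continuous fun p : ℝ × Pt d =>
      spDeriv d j (spDeriv d i u) (pA d σ p.1 z p.2) :=
    fun j => (cd_sp hv j).continuous.comp (pA_cont d σ z)
  have hg : Continuous (Function.uncurry g) := by
    have := hφ.continuous
    simp only [g, Function.uncurry_def]
    fun_prop
  have ftc : ∀ w, ∫ ρ in Ioc 0 R, g ρ w =
      φ w * spDeriv d i u (pA d σ R z w) - φ w * spDeriv d i u z := by
    intro w
    rw [← intervalIntegral.integral_of_le hR.le]
    rw [intervalIntegral.integral_eq_sub_of_hasDerivAt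
      (f := fun ρ => φ w * spDeriv d i u (pA d σ ρ z w))
      (fun ρ _ => (deriv_rho hv σ ρ z w).const_mul (φ w))]
    · simp [pA]
    · have : Continuous fun ρ => g ρ w := hg.comp (Continuous.prodMk_left w)
      exact this.intervalIntegrable _ _
  have hI : Integrable (Function.uncurry g) ((volume.restrict (Ioc 0 R)).prod volume) := by
    have h1 : IntegrableOn (Function.uncurry g) (Icc 0 R ×ˢ tsupport φ) :=
      hg.continuousOn.integrableOn_compact (isCompact_Icc.prod cφ)
    have h2 : IntegrableOn (Function.uncurry g) (Icc 0 R ×ˢ (univ : Set (Pt d))) := by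
      refine h1.of_forall_sdiff_eq_zero (measurableSet_Icc.prod MeasurableSet.univ) ?_
      rintro ⟨ρ, w⟩ hw
      simp only [Set.mem_sdiff, mem_prod, mem_univ, and_true, not_and] at hw
      have : φ w = 0 := image_eq_zero_of_notMem_tsupport (hw.2 hw.1)
      simp [g, this]
    have h3 := h2.mono_set (prod_mono_left (t := (univ : Set (Pt d))) (Ioc_subset_Icc_self))
    rw [IntegrableOn, Measure.volume_eq_prod, ← Measure.prod_restrict, Measure.restrict_univ] at h3
    exact h3
  have sw := integral_integral_swap hI
  have j1 : Integrable fun w => φ w * spDeriv d i u (pA d σ R z w) :=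
    (hφ.continuous.mul (hv.comp hA).continuous).integrable_of_hasCompactSupport cφ.mul_right
  have j2 : Integrable fun w => φ w * spDeriv d i u z :=
    (hφ.continuous.mul continuous_const).integrable_of_hasCompactSupport cφ.mul_right
  simp_rw [ftc] at sw
  rw [integral_sub j1 j2, integral_mul_const, hmass, one_mul] at sw
  have e1 : ∀ ρ, ∫ w, g ρ w = ∫ w, (-(2 * σ) * spDeriv d i (fun w => w.1 * φ w) w *
      timeDeriv d u (pA d σ ρ z w) + spDeriv d i B w * lap d u (pA d σ ρ z w)) :=
    fun ρ => inner_id hB hφ cB cφ hrel hu i σ ρ z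
  simp_rw [e1] at sw
  have e2 := ibp hφ cφ (hu.comp hA) i
  have e3 : ∀ w, spDeriv d i (u ∘ pA d σ R z) w = R * spDeriv d i u (pA d σ R z w) :=
    fun w => sp_comp hu σ R z w i
  simp_rw [e3] at e2
  have e4 : ∫ w, φ w * (R * spDeriv d i u (pA d σ R z w)) =
      R * ∫ w, φ w * spDeriv d i u (pA d σ R z w) := by
    rw [← integral_const_mul]; congr with w; ring
  rw [e4] at e2
  have e5 : ∫ w, φ w * spDeriv d i u (pA d σ R z w) =
      -(R⁻¹ * ∫ w, spDeriv d i φ w * u (pA d σ R z w)) := by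
    have : R * R⁻¹ = 1 := mul_inv_cancel₀ hR.ne'
    simp only [Function.comp_apply] at e2
    have := congrArg (fun x => R⁻¹ * x) e2
    rw [← mul_assoc, inv_mul_cancel₀ hR.ne', one_mul] at this
    rw [this]; ring
  rw [e5] at sw
  linarith

lemma enorm_bd {d : ℕ} {a : Pt d → ℝ} {U : Set (Pt d)} (hU : MeasurableSet U) {K : NNReal}
    (hK : ∀ w, ‖a w‖₊ ≤ K) (h0 : ∀ w, w ∉ U → a w = 0) (f : Pt d → ℝ) :
    ∫⁻ w, ‖a w * f w‖ₑ ≤ K * ∫⁻ w in U, ‖f w‖ₑ := by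
  rw [← lintegral_const_mul' _ _ ENNReal.coe_ne_top, ← lintegral_indicator hU]
  refine lintegral_mono fun w => ?_
  by_cases hw : w ∈ U
  · rw [indicator_of_mem hw, enorm_mul]
    refine mul_le_mul_left ?_ _
    exact ENNReal.coe_le_coe.2 (hK w)
  · simp [h0 w hw]

/-- unit cell -/
def uU (d : ℕ) : Set (Pt d) := Ioo 0 1 ×ˢ Metric.ball 0 1

lemma uU_meas (d : ℕ) : MeasurableSet (uU d) := measurableSet_Ioo.prod measurableSet_ball

lemma sp_supp {d : ℕ} {f : Pt d → ℝ} (hs : tsupport f ⊆ uU d) (i : Fin d) (w : Pt d)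
    (hw : w ∉ uU d) : spDeriv d i f w = 0 := by
  have h : w ∉ tsupport f := fun h => hw (hs h)
  exact image_eq_zero_of_notMem_tsupport
    (f := fun w => fderiv ℝ f w ((0 : ℝ), EuclideanSpace.single i (1 : ℝ)))
    fun h' => h (tsupport_fderiv_apply_subset ℝ _ h')

lemma sp_bound {d : ℕ} {f : Pt d → ℝ} (hf : ContDiff ℝ (⊤ : ℕ∞) f) (cf : HasCompactSupport f)
    (i : Fin d) : ∃ K : NNReal, ∀ w, ‖spDeriv d i f w‖₊ ≤ K := by
  obtain ⟨C, hC⟩ := (show HasCompactSupport (spDeriv d i f) from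
    cf.fderiv_apply (𝕜 := ℝ) _).exists_bound_of_continuous (cd_sp hf i).continuous
  have h0 : 0 ≤ C := (norm_nonneg _).trans (hC 0)
  exact ⟨⟨C, h0⟩, fun w => hC w⟩

lemma pt_est (d : ℕ) (hd : 1 ≤ d) (i : Fin d) : ∃ K : NNReal, ∀ u : Pt d → ℝ,
    ContDiff ℝ (⊤ : ℕ∞) u → ∀ (σ R : ℝ) (z : Pt d), |σ| = 1 → 0 < R →
    ‖spDeriv d i u z‖ₑ ≤ K * (ENNReal.ofReal R⁻¹ * (∫⁻ w in uU d, ‖u (pA d σ R z w)‖ₑ) +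
      ∫⁻ ρ in Ioc 0 R, ∫⁻ w in uU d,
        (‖timeDeriv d u (pA d σ ρ z w)‖ₑ + ‖lap d u (pA d σ ρ z w)‖ₑ)) := by
  obtain ⟨B, φ, hB, hφ, cB, cφ, sB, sφ, hrel, hmass⟩ := bump_exists d hd
  have hψ : ContDiff ℝ (⊤ : ℕ∞) (fun w : Pt d => w.1 * φ w) := contDiff_fst.mul hφ
  have cψ : HasCompactSupport (fun w : Pt d => w.1 * φ w) := cφ.mul_left
  have sψ : tsupport (fun w : Pt d => w.1 * φ w) ⊆ uU d :=
    (tsupport_mul_subset_right (f := fun w : Pt d => w.1) (g := φ)).trans sφ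
  obtain ⟨K1, h1⟩ := sp_bound hφ cφ i
  obtain ⟨K2, h2⟩ := sp_bound hψ cψ i
  obtain ⟨K3, h3⟩ := sp_bound hB cB i
  refine ⟨K1 + 2 * K2 + K3, fun u hu σ R z hσ hR => ?_⟩
  rw [rep_id hB hφ cB cφ hrel hmass hu i σ R hR z]
  set K := K1 + 2 * K2 + K3 with hK
  have k1 : ∀ w, ‖spDeriv d i φ w‖₊ ≤ K := fun w => (h1 w).trans (by
    rw [hK, add_assoc]; exact le_self_add)
  have k2 : ∀ w, ‖-(2 * σ) * spDeriv d i (fun w => w.1 * φ w) w‖₊ ≤ K := fun w => by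
    have e : ‖-(2 * σ)‖₊ = 2 := by
      ext; simp [hσ]
    rw [nnnorm_mul, e]
    calc 2 * _ ≤ 2 * K2 := mul_le_mul_right (h2 w) _
      _ ≤ K := by rw [hK, add_right_comm]; exact le_add_self
  have k3 : ∀ w, ‖spDeriv d i B w‖₊ ≤ K := fun w => (h3 w).trans le_add_self
  have hUm := uU_meas d
  refine (enorm_sub_le).trans ?_
  rw [mul_add]
  refine add_le_add ?_ ?_
  · rw [enorm_neg, enorm_mul, Real.enorm_of_nonneg (by positivity)]
    rw [mul_left_comm]
    refine mul_le_mul_right ?_ _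
    exact (enorm_integral_le_lintegral_enorm _).trans
      (enorm_bd hUm k1 (sp_supp sφ i) _)
  · refine (enorm_integral_le_lintegral_enorm _).trans ?_
    rw [← lintegral_const_mul' _ _ ENNReal.coe_ne_top]
    refine lintegral_mono fun ρ => ?_
    refine (enorm_integral_le_lintegral_enorm _).trans ?_
    have m1 : Measurable fun w => ‖timeDeriv d u (pA d σ ρ z w)‖ₑ :=
      ((cd_time hu).comp (pA_cd d σ ρ z)).continuous.measurable.enorm
    have m2 : Measurable fun w => ‖-(2 * σ) * spDeriv d i (fun w => w.1 * φ w) w *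
        timeDeriv d u (pA d σ ρ z w)‖ₑ :=
      ((continuous_const.mul (cd_sp hψ i).continuous).mul
        ((cd_time hu).comp (pA_cd d σ ρ z)).continuous).measurable.enorm
    calc _ ≤ ∫⁻ w, (‖-(2 * σ) * spDeriv d i (fun w => w.1 * φ w) w *
          timeDeriv d u (pA d σ ρ z w)‖ₑ + ‖spDeriv d i B w * lap d u (pA d σ ρ z w)‖ₑ) :=
          lintegral_mono fun w => enorm_add_le _ _
      _ = _ := lintegral_add_left m2 _
      _ ≤ _ := add_le_add (enorm_bd hUm k2 (fun w hw => by simp [sp_supp sψ i w hw]) _)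
          (enorm_bd hUm k3 (sp_supp sB i) _)
      _ = _ := by rw [← mul_add, lintegral_add_left m1]

lemma map_affine {E : Type*} [NormedAddCommGroup E] [NormedSpace ℝ E] [MeasurableSpace E]
    [BorelSpace E] [FiniteDimensional ℝ E] (μ : Measure E) [μ.IsAddHaarMeasure] (c : E) {a : ℝ}
    (ha : a ≠ 0) : Measure.map (fun x => c + a • x) μ =
      ENNReal.ofReal (abs (a ^ Module.finrank ℝ E)⁻¹) • μ := by
  have : (fun x : E => c + a • x) = (fun x => c + x) ∘ (fun x => a • x) := rfl
  rw [this, ← Measure.map_map (measurable_const_add c) (measurable_const_smul a),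
    Measure.map_addHaar_smul μ ha, Measure.map_smul, map_add_left_eq_self]

lemma map_pA (d : ℕ) {σ ρ : ℝ} (hσ : |σ| = 1) (hρ : 0 < ρ) (z : Pt d) :
    Measure.map (pA d σ ρ z) volume = (ENNReal.ofReal (ρ ^ (d + 2)))⁻¹ • volume := by
  have e : pA d σ ρ z = Prod.map (fun s => z.1 + (σ * ρ ^ 2) • s) (fun y => z.2 + ρ • y) := by
    ext1 w; rfl
  have hσ0 : σ ≠ 0 := by rintro rfl; simp at hσ
  have h0 : σ * ρ ^ 2 ≠ 0 := by positivity
  rw [e, Measure.volume_eq_prod, ← Measure.map_prod_map _ _ (by fun_prop) (by fun_prop),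
    map_affine _ _ h0, map_affine _ _ hρ.ne', Measure.prod_smul_left, Measure.prod_smul_right,
    smul_smul]
  congr 1
  rw [← ENNReal.ofReal_mul (by positivity), ← ENNReal.ofReal_inv_of_pos (by positivity)]
  congr 1
  simp only [Module.finrank_self, pow_one, finrank_euclideanSpace, Fintype.card_fin, abs_inv,
    abs_mul, hσ, abs_pow, abs_of_pos hρ]
  rw [pow_add]; field_simp

lemma cov (d : ℕ) {σ ρ : ℝ} (hσ : |σ| = 1) (hρ : 0 < ρ) (z : Pt d) {Q : Set (Pt d)}
    (hQ : MeasurableSet Q) (hin : ∀ w ∈ uU d, pA d σ ρ z w ∈ Q) {F : Pt d → ℝ≥0∞}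
    (hF : Measurable F) :
    ∫⁻ w in uU d, F (pA d σ ρ z w) ≤ 2 * omegaD d * sAvg d ρ z (Q.indicator F) := by
  have hm : Measurable ((sCyl d ρ z).indicator (Q.indicator F)) :=
    (hF.indicator hQ).indicator (measurableSet_sCyl d ρ z)
  have h1 : ∫⁻ w in uU d, F (pA d σ ρ z w) ≤
      ∫⁻ w, (sCyl d ρ z).indicator (Q.indicator F) (pA d σ ρ z w) := by
    rw [← lintegral_indicator (uU_meas d)]
    refine lintegral_mono fun w => ?_
    by_cases hw : w ∈ uU d
    · have h2 : pA d σ ρ z w ∈ sCyl d ρ z := by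
        obtain ⟨⟨a, b⟩, c⟩ := hw
        simp only [mem_ball_zero_iff] at c
        simp only [sCyl, pA, mem_prod, Metric.mem_ball, dist_self_add_left, norm_smul, norm_mul,
          Real.norm_eq_abs, hσ, abs_pow, abs_of_pos hρ, abs_of_pos a, one_mul]
        constructor
        · have : 0 < ρ ^ 2 := by positivity
          nlinarith
        · nlinarith
      rw [indicator_of_mem hw, indicator_of_mem h2, indicator_of_mem (hin w hw)]
    · simp [hw]
  refine h1.trans ?_
  rw [← lintegral_map (f := (sCyl d ρ z).indicator (Q.indicator F)) hm
    (pA_cd d σ ρ z).continuous.measurable, map_pA d hσ hρ, lintegral_smul_measure,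
    lintegral_indicator (measurableSet_sCyl d ρ z), sAvg, vol_sCyl d hρ]
  have a1 : 2 * omegaD d ≠ 0 := mul_ne_zero (by simp) (omegaD_pos d)
  have a2 : 2 * omegaD d ≠ ∞ := ENNReal.mul_ne_top (by simp) (omegaD_fin d)
  rw [ENNReal.mul_inv (Or.inl a1) (Or.inl a2), ← mul_assoc, ← mul_assoc,
    ENNReal.mul_inv_cancel a1 a2, one_mul]
  exact le_rfl

/-- comparison of averages for comparable radii -/
lemma sAvg_compare (d : ℕ) {R ρ : ℝ} (hR : 0 < R) (h1 : R ≤ ρ) (h2 : ρ ≤ 2 * R) (z : Pt d)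
    (f : Pt d → ℝ≥0∞) : sAvg d R z f ≤ ENNReal.ofReal (2 ^ (d + 2)) * sAvg d ρ z f := by
  have hρ : 0 < ρ := by linarith
  unfold sAvg
  have hsub : sCyl d R z ⊆ sCyl d ρ z :=
    prod_mono (Metric.ball_subset_ball (by gcongr)) (Metric.ball_subset_ball h1)
  rw [← mul_assoc]
  refine mul_le_mul' ?_ (lintegral_mono_set hsub)
  have hv : volume (sCyl d ρ z) ≤ ENNReal.ofReal (2 ^ (d + 2)) * volume (sCyl d R z) := by
    rw [← vol_sCyl_scale d (by norm_num) hR z z]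
    exact measure_mono (prod_mono (Metric.ball_subset_ball (by gcongr)) (Metric.ball_subset_ball h2))
  have c0 : ENNReal.ofReal (2 ^ (d + 2)) ≠ 0 := by
    rw [Ne, ENNReal.ofReal_eq_zero, not_le]; positivity
  calc (volume (sCyl d R z))⁻¹ = ENNReal.ofReal (2 ^ (d + 2)) *
        (ENNReal.ofReal (2 ^ (d + 2)) * volume (sCyl d R z))⁻¹ := by
        rw [ENNReal.mul_inv (Or.inl c0) (Or.inl ENNReal.ofReal_ne_top), ← mul_assoc,
          ENNReal.mul_inv_cancel c0 ENNReal.ofReal_ne_top, one_mul]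
    _ ≤ _ := mul_le_mul_right (ENNReal.inv_le_inv.2 hv) _

lemma sAvg_R (d : ℕ) {R : ℝ} (hR : 0 < R) (z : Pt d) (f : Pt d → ℝ≥0∞) :
    ENNReal.ofReal R⁻¹ * sAvg d R z f ≤ ENNReal.ofReal (2 ^ (d + 2)) *
      (ENNReal.ofReal (R ^ 2)⁻¹ * JP d f z) := by
  have h : ENNReal.ofReal R * sAvg d R z f ≤ ENNReal.ofReal (2 ^ (d + 2)) * JP d f z := by
    calc ENNReal.ofReal R * sAvg d R z f = ∫⁻ ρ in Ioc R (2 * R), sAvg d R z f := by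
          rw [setLIntegral_const, Real.volume_Ioc, mul_comm]; congr 2; ring
      _ ≤ ∫⁻ ρ in Ioc R (2 * R), ENNReal.ofReal (2 ^ (d + 2)) * sAvg d ρ z f :=
          setLIntegral_mono' measurableSet_Ioc fun ρ hρ => sAvg_compare d hR hρ.1.le hρ.2 z f
      _ = ENNReal.ofReal (2 ^ (d + 2)) * ∫⁻ ρ in Ioc R (2 * R), sAvg d ρ z f :=
          lintegral_const_mul' _ _ (by simp)
      _ ≤ _ := by
          refine mul_le_mul_right (lintegral_mono_set ?_) _
          intro ρ hρ
          exact hR.trans hρ.1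
  calc _ = ENNReal.ofReal (R ^ 2)⁻¹ * (ENNReal.ofReal R * sAvg d R z f) := by
        rw [← mul_assoc, ← ENNReal.ofReal_mul (by positivity)]
        congr 2; field_simp
    _ ≤ _ := mul_le_mul_right h _
    _ = _ := by ring

lemma JP_mono {d : ℕ} {f g : Pt d → ℝ≥0∞} (h : ∀ w, f w ≤ g w) (z : Pt d) :
    JP d f z ≤ JP d g z :=
  lintegral_mono fun _ => sAvg_mono fun w _ => h w

lemma JP_const_mul {d : ℕ} {f : Pt d → ℝ≥0∞} {c : ℝ≥0∞} (hc : c ≠ ∞) (z : Pt d) :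
    JP d (fun w => c * f w) z = c * JP d f z := by
  unfold JP
  rw [← lintegral_const_mul' _ _ hc]
  congr with ρ
  exact sAvg_const_mul z c f hc

lemma dom_i (d : ℕ) (hd : 1 ≤ d) (i : Fin d) : ∃ K : ℝ≥0∞, K ≠ ∞ ∧ ∀ u : Pt d → ℝ,
    ContDiff ℝ (⊤ : ℕ∞) u → ∀ S T : ℝ, S < T → ∀ z ∈ Ioo S T ×ˢ (univ : Set (Ed d)),
    ‖spDeriv d i u z‖ₑ ≤ K * JP d ((Ioo S T ×ˢ (univ : Set (Ed d))).indicator fun w =>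
      ENNReal.ofReal (|timeDeriv d u w| + |lap d u w|) +
        ENNReal.ofReal (T - S)⁻¹ * ENNReal.ofReal |u w|) z := by
  obtain ⟨K, hK⟩ := pt_est d hd i
  have hω : 2 * omegaD d ≠ ∞ := ENNReal.mul_ne_top (by simp) (omegaD_fin d)
  refine ⟨K * (2 * omegaD d * (ENNReal.ofReal (2 ^ (d + 2)) * 2 + 1)),
    ENNReal.mul_ne_top (by simp) (ENNReal.mul_ne_top hω (by finiteness)), ?_⟩
  intro u hu S T hST z hz
  set Q : Set (Pt d) := Ioo S T ×ˢ (univ : Set (Ed d)) with hQ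
  have hQm : MeasurableSet Q := measurableSet_Ioo.prod MeasurableSet.univ
  set G := Q.indicator fun w => ENNReal.ofReal (|timeDeriv d u w| + |lap d u w|) +
        ENNReal.ofReal (T - S)⁻¹ * ENNReal.ofReal |u w| with hG
  have hTS : 0 < T - S := by linarith
  obtain ⟨R, hR, hR2⟩ : ∃ R : ℝ, 0 < R ∧ R ^ 2 = (T - S) / 2 :=
    ⟨√((T - S) / 2), by positivity, Real.sq_sqrt (by positivity)⟩
  obtain ⟨σ, hσ, hin⟩ : ∃ σ : ℝ, |σ| = 1 ∧ ∀ ρ, 0 < ρ → ρ ≤ R → ∀ w ∈ uU d,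
      pA d σ ρ z w ∈ Q := by
    have key : ∀ ρ, 0 < ρ → ρ ≤ R → ∀ w ∈ uU d, 0 < ρ ^ 2 * w.1 ∧ ρ ^ 2 * w.1 < (T - S) / 2 := by
      intro ρ h0 h1 w hw
      obtain ⟨⟨a, b⟩, _⟩ := hw
      refine ⟨by positivity, ?_⟩
      have : ρ ^ 2 ≤ R ^ 2 := by gcongr
      nlinarith
    have hz1 : S < z.1 ∧ z.1 < T := hz.1
    by_cases hc : z.1 < (S + T) / 2
    · refine ⟨1, by simp, fun ρ h0 h1 w hw => ⟨?_, mem_univ _⟩⟩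
      have := key ρ h0 h1 w hw
      simp only [pA, mem_Ioo, one_mul]
      constructor <;> linarith
    · refine ⟨-1, by simp, fun ρ h0 h1 w hw => ⟨?_, mem_univ _⟩⟩
      have := key ρ h0 h1 w hw
      simp only [pA, mem_Ioo, neg_mul, one_mul]
      constructor <;> linarith
  have mu : Measurable fun w => ‖u w‖ₑ := hu.continuous.measurable.enorm
  have mf : Measurable fun w => ‖timeDeriv d u w‖ₑ + ‖lap d u w‖ₑ :=
    (cd_time hu).continuous.measurable.enorm.add (cd_lap hu).continuous.measurable.enorm
  have hc0 : ENNReal.ofReal (T - S)⁻¹ ≠ ∞ := by simp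
  have g1 : ENNReal.ofReal (T - S)⁻¹ * JP d (Q.indicator fun w => ‖u w‖ₑ) z ≤ JP d G z := by
    rw [← JP_const_mul hc0]
    refine JP_mono (fun w => ?_) z
    by_cases hw : w ∈ Q
    · rw [hG, indicator_of_mem hw, indicator_of_mem hw, Real.enorm_eq_ofReal_abs]
      exact le_add_self
    · simp [hw]
  have g2 : JP d (Q.indicator fun w => ‖timeDeriv d u w‖ₑ + ‖lap d u w‖ₑ) z ≤ JP d G z := by
    refine JP_mono (fun w => ?_) z
    by_cases hw : w ∈ Q
    · rw [hG, indicator_of_mem hw, indicator_of_mem hw, Real.enorm_eq_ofReal_abs,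
        Real.enorm_eq_ofReal_abs, ← ENNReal.ofReal_add (abs_nonneg _) (abs_nonneg _)]
      exact le_self_add
    · simp [hw]
  refine (hK u hu σ R z hσ hR).trans ?_
  rw [mul_assoc]
  refine mul_le_mul_right ?_ _
  rw [mul_assoc, add_mul, mul_add, one_mul]
  refine add_le_add ?_ ?_
  · calc _ ≤ ENNReal.ofReal R⁻¹ * (2 * omegaD d * sAvg d R z (Q.indicator fun w => ‖u w‖ₑ)) :=
          mul_le_mul_right (cov d hσ hR z hQm (hin R hR le_rfl) mu) _
      _ = 2 * omegaD d * (ENNReal.ofReal R⁻¹ * sAvg d R z (Q.indicator fun w => ‖u w‖ₑ)) := by ring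
      _ ≤ 2 * omegaD d * (ENNReal.ofReal (2 ^ (d + 2)) * (ENNReal.ofReal (R ^ 2)⁻¹ *
            JP d (Q.indicator fun w => ‖u w‖ₑ) z)) := mul_le_mul_right (sAvg_R d hR z _) _
      _ = 2 * omegaD d * (ENNReal.ofReal (2 ^ (d + 2)) * 2 * (ENNReal.ofReal (T - S)⁻¹ *
            JP d (Q.indicator fun w => ‖u w‖ₑ) z)) := by
          rw [hR2, inv_div, div_eq_mul_inv, ENNReal.ofReal_mul (by norm_num), ENNReal.ofReal_ofNat]
          ring
      _ ≤ _ := mul_le_mul_right (mul_le_mul_right g1 _) _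
  · calc _ ≤ ∫⁻ ρ in Ioc 0 R, 2 * omegaD d *
          sAvg d ρ z (Q.indicator fun w => ‖timeDeriv d u w‖ₑ + ‖lap d u w‖ₑ) :=
          setLIntegral_mono' measurableSet_Ioc fun ρ hρ =>
            cov d hσ hρ.1 z hQm (hin ρ hρ.1 hρ.2) mf
      _ = 2 * omegaD d * ∫⁻ ρ in Ioc 0 R,
          sAvg d ρ z (Q.indicator fun w => ‖timeDeriv d u w‖ₑ + ‖lap d u w‖ₑ) :=
          lintegral_const_mul' _ _ hω
      _ ≤ 2 * omegaD d * JP d (Q.indicator fun w => ‖timeDeriv d u w‖ₑ + ‖lap d u w‖ₑ) z :=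
          mul_le_mul_right (lintegral_mono_set Ioc_subset_Ioi_self) _
      _ ≤ _ := mul_le_mul_right g2 _

lemma dom (d : ℕ) (hd : 1 ≤ d) : ∃ K : ℝ, 0 < K ∧ ∀ u : Pt d → ℝ,
    ContDiff ℝ (⊤ : ℕ∞) u → ∀ S T : ℝ, S < T → ∀ z ∈ Ioo S T ×ˢ (univ : Set (Ed d)),
    ENNReal.ofReal (gradNorm d u z) ≤ ENNReal.ofReal K *
      JP d ((Ioo S T ×ˢ (univ : Set (Ed d))).indicator fun w =>
      ENNReal.ofReal (|timeDeriv d u w| + |lap d u w|) +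
        ENNReal.ofReal (T - S)⁻¹ * ENNReal.ofReal |u w|) z := by
  choose K hK h using dom_i d hd
  have hs : ∑ i, K i ≠ ∞ := ENNReal.sum_ne_top.2 fun i _ => hK i
  refine ⟨(∑ i, K i).toReal + 1, by positivity, fun u hu S T hST z hz => ?_⟩
  have h1 : gradNorm d u z ≤ ∑ i, |spDeriv d i u z| := by
    unfold gradNorm
    refine Real.sqrt_le_iff.2 ⟨Finset.sum_nonneg fun i _ => abs_nonneg _, ?_⟩
    have := Finset.sum_sq_le_sq_sum_of_nonneg (s := Finset.univ)
      (f := fun i => |spDeriv d i u z|) (fun i _ => abs_nonneg _)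
    simpa using this
  calc _ ≤ ENNReal.ofReal (∑ i, |spDeriv d i u z|) := ENNReal.ofReal_le_ofReal h1
    _ = ∑ i, ‖spDeriv d i u z‖ₑ := by
        rw [ENNReal.ofReal_sum_of_nonneg fun i _ => abs_nonneg _]
        simp_rw [Real.enorm_eq_ofReal_abs]
    _ ≤ ∑ i, K i * _ := Finset.sum_le_sum fun i _ => h i u hu S T hST z hz
    _ = (∑ i, K i) * _ := by rw [Finset.sum_mul]
    _ ≤ _ := by
        refine mul_le_mul_left ?_ _
        rw [ENNReal.ofReal_add (by positivity) (by norm_num), ENNReal.ofReal_toReal hs]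
        exact le_self_add

lemma pAvg_eq (d : ℕ) (ρ : ℝ) (z : Pt d) (f : Pt d → ℝ≥0∞) :
    pAvg d ρ z f = ∫⁻ w, f w ∂((volume (pCyl d ρ z))⁻¹ • volume.restrict (pCyl d ρ z)) := by
  rw [lintegral_smul_measure]; rfl

lemma vol_pCyl_ne_zero (d : ℕ) {ρ : ℝ} (hρ : 0 < ρ) (z : Pt d) : volume (pCyl d ρ z) ≠ 0 := by
  rw [vol_pCyl d hρ]
  refine mul_ne_zero (omegaD_pos d) ?_
  rw [Ne, ENNReal.ofReal_eq_zero, not_le]; positivity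

lemma vol_pCyl_ne_top (d : ℕ) {ρ : ℝ} (hρ : 0 < ρ) (z : Pt d) : volume (pCyl d ρ z) ≠ ∞ := by
  rw [vol_pCyl d hρ]
  exact ENNReal.mul_ne_top (omegaD_fin d) (by simp)

lemma morrey_add (d : ℕ) {q β : ℝ} (hq : 1 < q) {Q : Set (Pt d)} (hQ : MeasurableSet Q)
    {f g : Pt d → ℝ≥0∞} (hf : Measurable f) (hg : Measurable g) (c : ℝ≥0∞) (hc : c ≠ ∞) :
    MorreyNorm d q β Q (fun w => f w + c * g w) ≤
      MorreyNorm d q β Q f + c * MorreyNorm d q β Q g := by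
  refine iSup_le fun ρ => iSup_le fun hρ => iSup_le fun z => iSup_le fun hz => ?_
  have hq0 : 0 < q := by linarith
  have m1 : ENNReal.ofReal (ρ ^ β) * (pAvg d ρ z fun w => Q.indicator f w ^ q) ^ (1 / q) ≤
      MorreyNorm d q β Q f := le_iSup_of_le ρ (le_iSup_of_le hρ (le_iSup_of_le z (le_iSup_of_le hz le_rfl)))
  have m2 : ENNReal.ofReal (ρ ^ β) * (pAvg d ρ z fun w => Q.indicator g w ^ q) ^ (1 / q) ≤
      MorreyNorm d q β Q g := le_iSup_of_le ρ (le_iSup_of_le hρ (le_iSup_of_le z (le_iSup_of_le hz le_rfl)))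
  refine le_trans ?_ (add_le_add m1 (mul_le_mul_right m2 c))
  rw [mul_left_comm, ← mul_add]
  refine mul_le_mul_right ?_ _
  simp only [pAvg_eq]
  set ν := (volume (pCyl d ρ z))⁻¹ • volume.restrict (pCyl d ρ z)
  have e : (Q.indicator fun w => f w + c * g w) =
      Q.indicator f + fun w => c * Q.indicator g w := by
    ext w
    by_cases hw : w ∈ Q <;> simp [hw]
  have h := ENNReal.lintegral_Lp_add_le (μ := ν) (p := q) (f := Q.indicator f)
    (g := fun w => c * Q.indicator g w) (hf.indicator hQ).aemeasurable
    ((hg.indicator hQ).const_mul c).aemeasurable hq.le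
  rw [e]
  refine h.trans (add_le_add le_rfl (le_of_eq ?_))
  simp_rw [ENNReal.mul_rpow_of_nonneg _ _ hq0.le]
  rw [lintegral_const_mul' _ _ (ENNReal.rpow_ne_top_of_nonneg hq0.le hc),
    ENNReal.mul_rpow_of_nonneg _ _ (by positivity), ← ENNReal.rpow_mul,
    mul_one_div_cancel hq0.ne', ENNReal.rpow_one]

lemma morrey_pCyl (d : ℕ) {q β : ℝ} (hq : 1 < q) {Q : Set (Pt d)}
    {f : Pt d → ℝ≥0∞} {a : ℝ} (ha : 0 < a) (hA : MorreyNorm d q β Q f ≤ ENNReal.ofReal a)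
    {ρ : ℝ} (hρ : 0 < ρ) {z : Pt d} (hz : z ∈ Q) :
    ∫⁻ w in pCyl d ρ z, Q.indicator f w ^ q ≤
      volume (pCyl d ρ z) * ENNReal.ofReal ((a * ρ ^ (-β)) ^ q) := by
  have hq0 : 0 < q := by linarith
  have m1 : ENNReal.ofReal (ρ ^ β) * (pAvg d ρ z fun w => Q.indicator f w ^ q) ^ (1 / q) ≤
      ENNReal.ofReal a := by
    refine le_trans ?_ hA
    exact le_iSup_of_le ρ (le_iSup_of_le hρ (le_iSup_of_le z (le_iSup_of_le hz le_rfl)))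
  have p0 : 0 < ρ ^ β := by positivity
  have m2 : (pAvg d ρ z fun w => Q.indicator f w ^ q) ^ (1 / q) ≤ ENNReal.ofReal (a * ρ ^ (-β)) := by
    have := mul_le_mul_right m1 (ENNReal.ofReal (ρ ^ (-β)))
    rw [← mul_assoc, ← ENNReal.ofReal_mul (by positivity), ← Real.rpow_add hρ,
      ← ENNReal.ofReal_mul (by positivity)] at this
    simpa [mul_comm] using this
  have m3 : (pAvg d ρ z fun w => Q.indicator f w ^ q) ≤ ENNReal.ofReal ((a * ρ ^ (-β)) ^ q) := by
    have := ENNReal.rpow_le_rpow m2 hq0.le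
    rwa [← ENNReal.rpow_mul, one_div_mul_cancel hq0.ne', ENNReal.rpow_one,
      ENNReal.ofReal_rpow_of_nonneg (by positivity) hq0.le] at this
  calc _ = volume (pCyl d ρ z) * (pAvg d ρ z fun w => Q.indicator f w ^ q) := by
        rw [pAvg, ← mul_assoc, ENNReal.mul_inv_cancel (vol_pCyl_ne_zero d hρ z)
          (vol_pCyl_ne_top d hρ z), one_mul]
    _ ≤ _ := mul_le_mul_right m3 _

lemma morrey_sym (d : ℕ) {q β S T : ℝ} (hq : 1 < q) (hβ : 1 < β)
    {f : Pt d → ℝ≥0∞} {a : ℝ} (ha : 0 < a)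
    (hA : MorreyNorm d q β (Ioo S T ×ˢ (univ : Set (Ed d))) f ≤ ENNReal.ofReal a)
    {ρ : ℝ} (hρ : 0 < ρ) (z : Pt d) :
    sAvg d ρ z (fun w => (Ioo S T ×ˢ (univ : Set (Ed d))).indicator f w ^ q) ≤
      ENNReal.ofReal ((2 ^ (d + 2) * a * ρ ^ (-β)) ^ q) := by
  have hq0 : 0 < q := by linarith
  set Q : Set (Pt d) := Ioo S T ×ˢ (univ : Set (Ed d)) with hQ
  have hQm : MeasurableSet Q := measurableSet_Ioo.prod MeasurableSet.univ
  set m := max (z.1 - ρ ^ 2) S with hm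
  have hms : S ≤ m := le_max_right _ _
  have hmz : z.1 - ρ ^ 2 ≤ m := le_max_left _ _
  let E : ℕ → Set (Pt d) := fun n => (sCyl d ρ z ∩ Q) ∩ {w | m + 1 / ((n : ℝ) + 1) ≤ w.1}
  have hρ2 : 0 < ρ ^ 2 := by positivity
  have hun : sCyl d ρ z ∩ Q ⊆ ⋃ n, E n := by
    intro w hw
    have h1 : m < w.1 := by
      refine max_lt ?_ hw.2.1.1
      have := hw.1.1
      rw [Metric.mem_ball, Real.dist_eq, abs_lt] at this
      linarith
    obtain ⟨n, hn⟩ := exists_nat_one_div_lt (sub_pos.2 h1)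
    exact mem_iUnion.2 ⟨n, hw, by simp only [mem_ofPred_eq]; linarith⟩
  have hdir : Directed (· ⊆ ·) E := by
    refine Monotone.directed_le fun n k hnk => ?_
    rintro w ⟨hw, h⟩
    refine ⟨hw, ?_⟩
    simp only [mem_ofPred_eq] at h ⊢
    have : 1 / ((k : ℝ) + 1) ≤ 1 / ((n : ℝ) + 1) := by gcongr
    linarith
  have hEn : ∀ n, ∫⁻ w in E n, Q.indicator f w ^ q ≤
      ENNReal.ofReal (2 ^ (d + 2)) * (omegaD d * ENNReal.ofReal (ρ ^ (d + 2))) *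
        ENNReal.ofReal ((a * ρ ^ (-β)) ^ q) := by
    intro n
    have hn0 : 0 < 1 / ((n : ℝ) + 1) := by positivity
    rcases (E n).eq_empty_or_nonempty with h | ⟨w, hw⟩
    · simp [h]
    · have hc : ((m + 1 / ((n : ℝ) + 1), z.2) : Pt d) ∈ Q := by
        refine ⟨⟨by simp only []; linarith, ?_⟩, mem_univ _⟩
        exact lt_of_le_of_lt hw.2 hw.1.2.1.2
      have hsub : E n ⊆ pCyl d (2 * ρ) (m + 1 / ((n : ℝ) + 1), z.2) := by
        rintro y ⟨⟨⟨y1, y2⟩, _⟩, y3⟩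
        rw [Metric.mem_ball, Real.dist_eq, abs_lt] at y1
        rw [Metric.mem_ball, dist_comm] at y2
        refine ⟨by simp only []; linarith, y3, ?_⟩
        simp only []
        nlinarith
      refine (lintegral_mono_set hsub).trans ((morrey_pCyl d hq ha hA (by positivity) hc).trans ?_)
      rw [vol_pCyl d (by positivity), mul_pow, ENNReal.ofReal_mul (by positivity),
        mul_left_comm (omegaD d)]
      refine mul_le_mul_right ?_ _
      refine ENNReal.ofReal_le_ofReal ?_
      refine Real.rpow_le_rpow (by positivity) ?_ hq0.le
      refine mul_le_mul_of_nonneg_left ?_ ha.le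
      exact Real.rpow_le_rpow_of_nonpos hρ (by linarith) (by linarith)
  have hs : ∫⁻ w in sCyl d ρ z, Q.indicator f w ^ q ≤
      ENNReal.ofReal (2 ^ (d + 2)) * (omegaD d * ENNReal.ofReal (ρ ^ (d + 2))) *
        ENNReal.ofReal ((a * ρ ^ (-β)) ^ q) := by
    calc _ = ∫⁻ w in sCyl d ρ z ∩ Q, Q.indicator f w ^ q := by
          rw [inter_comm, ← setLIntegral_indicator hQm]
          congr with w
          by_cases hw : w ∈ Q <;> simp [hw, hq0]
      _ ≤ ∫⁻ w in ⋃ n, E n, Q.indicator f w ^ q := lintegral_mono_set hun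
      _ = ⨆ n, ∫⁻ w in E n, Q.indicator f w ^ q := setLIntegral_iUnion_of_directed _ hdir
      _ ≤ _ := iSup_le hEn
  unfold sAvg
  have hv : ENNReal.ofReal (2 ^ (d + 2)) * (omegaD d * ENNReal.ofReal (ρ ^ (d + 2))) ≤
      ENNReal.ofReal (2 ^ (d + 2)) * volume (sCyl d ρ z) := by
    rw [vol_sCyl d hρ, mul_assoc 2, two_mul]
    exact mul_le_mul_right le_self_add _
  calc _ ≤ (volume (sCyl d ρ z))⁻¹ * (ENNReal.ofReal (2 ^ (d + 2)) * volume (sCyl d ρ z) *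
        ENNReal.ofReal ((a * ρ ^ (-β)) ^ q)) :=
        mul_le_mul_right (hs.trans (mul_le_mul_left hv _)) _
    _ = ((volume (sCyl d ρ z))⁻¹ * volume (sCyl d ρ z)) * (ENNReal.ofReal (2 ^ (d + 2)) *
        ENNReal.ofReal ((a * ρ ^ (-β)) ^ q)) := by ring
    _ = ENNReal.ofReal (2 ^ (d + 2) * (a * ρ ^ (-β)) ^ q) := by
        rw [ENNReal.inv_mul_cancel (vol_sCyl_ne_zero d hρ z) (vol_sCyl_ne_top d hρ z), one_mul,
          ← ENNReal.ofReal_mul (by positivity)]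
    _ ≤ _ := by
        refine ENNReal.ofReal_le_ofReal ?_
        rw [mul_assoc, Real.mul_rpow (x := 2 ^ (d + 2)) (by positivity) (by positivity)]
        refine mul_le_mul_of_nonneg_right ?_ (by positivity)
        have h1 : (1 : ℝ) ≤ 2 ^ (d + 2) := one_le_pow₀ (by norm_num)
        simpa using Real.rpow_le_rpow_of_exponent_le h1 hq.le

lemma pAvg_le_sAvg (d : ℕ) {ρ : ℝ} (hρ : 0 < ρ) (z : Pt d) (f : Pt d → ℝ≥0∞) :
    pAvg d ρ z f ≤ 2 * sAvg d ρ z f := by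
  unfold pAvg sAvg
  have hsub : pCyl d ρ z ⊆ sCyl d ρ z := by
    rintro w ⟨h1, h2, h3⟩
    refine ⟨?_, ?_⟩
    · rw [Metric.mem_ball, Real.dist_eq, abs_lt]
      have : 0 < ρ ^ 2 := by positivity
      constructor <;> linarith
    · rwa [Metric.mem_ball, dist_comm]
  rw [← mul_assoc]
  refine mul_le_mul' (le_of_eq ?_) (lintegral_mono_set hsub)
  rw [vol_sCyl d hρ, vol_pCyl d hρ, mul_assoc 2, ENNReal.mul_inv (a := 2) (by simp) (by simp),
    ← mul_assoc, ENNReal.mul_inv_cancel (by simp) (by simp), one_mul]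

/-- Theorem 3.7: for `1 < q < d+2`, `β ∈ (1,(d+2)/q]`, `r(β−1) = qβ`,
on `Q_{S,T} = (S,T) × ℝ^d` one has
`‖Du‖_{E_{r,β−1}(Q)} ≤ N ‖|∂_t u|+|Δu|‖_{E_{q,β}(Q)} + N (T−S)⁻¹ ‖u‖_{E_{q,β}(Q)}`. -/
theorem stmt9 (d : ℕ) (hd : 1 ≤ d) (q β r : ℝ) (hq : 1 < q) (hq' : q < (d : ℝ) + 2)
    (hβ : 1 < β) (hβ' : β ≤ ((d : ℝ) + 2) / q) (hr : r * (β - 1) = q * β) :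
    ∃ N : ℝ, 0 < N ∧ ∀ u : Pt d → ℝ, ContDiff ℝ (⊤ : ℕ∞) u → HasCompactSupport u →
      ∀ S T : ℝ, S < T →
        MorreyNorm d r (β - 1) (Ioo S T ×ˢ (univ : Set (Ed d)))
            (fun z => ENNReal.ofReal (gradNorm d u z)) ≤
          ENNReal.ofReal N * MorreyNorm d q β (Ioo S T ×ˢ (univ : Set (Ed d)))
              (fun z => ENNReal.ofReal (|timeDeriv d u z| + |lap d u z|)) +
            ENNReal.ofReal (N * (T - S)⁻¹) * MorreyNorm d q β (Ioo S T ×ˢ (univ : Set (Ed d)))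
              (fun z => ENNReal.ofReal |u z|) := by
  obtain ⟨K, hK, hdom⟩ := dom d hd
  obtain ⟨N0, hN0, hpot⟩ := morrey_pot d hq hβ hr
  have hb : 0 < β - 1 := by linarith
  have hr0 : 0 < r := by
    by_contra h
    have : r * (β - 1) ≤ 0 := mul_nonpos_of_nonpos_of_nonneg (not_lt.1 h) hb.le
    have : 0 < q * β := by positivity
    linarith
  refine ⟨(2 * K ^ r * N0) ^ (1 / r) * 2 ^ (d + 2), by positivity, fun u hu _ S T hST => ?_⟩
  set N := (2 * K ^ r * N0) ^ (1 / r) * 2 ^ (d + 2) with hN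
  have hNp : 0 < N := by positivity
  set Q : Set (Pt d) := Ioo S T ×ˢ (univ : Set (Ed d)) with hQ
  have hQm : MeasurableSet Q := measurableSet_Ioo.prod MeasurableSet.univ
  set f : Pt d → ℝ≥0∞ := fun z => ENNReal.ofReal (|timeDeriv d u z| + |lap d u z|) with hf
  set g : Pt d → ℝ≥0∞ := fun z => ENNReal.ofReal |u z| with hg
  have mf : Measurable f := by
    have := (cd_time hu).continuous
    have := (cd_lap hu).continuous
    exact ENNReal.measurable_ofReal.comp (by fun_prop : Continuous fun z => |timeDeriv d u z| + |lap d u z|).measurable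
  have mg : Measurable g := by
    have := hu.continuous
    exact ENNReal.measurable_ofReal.comp (by fun_prop : Continuous fun z => |u z|).measurable
  set c := ENNReal.ofReal (T - S)⁻¹ with hc
  have hadd := morrey_add d hq (β := β) hQm mf mg c (by simp [hc])
  rw [ENNReal.ofReal_mul hNp.le, mul_assoc, ← mul_add, ← hc]
  generalize MorreyNorm d q β Q f + c * MorreyNorm d q β Q g = A at hadd ⊢
  by_cases hAt : A = ∞
  · rw [hAt, ENNReal.mul_top (by simpa using hNp)]; exact le_top
  refine ENNReal.le_of_forall_pos_le_add fun ε hε _ => ?_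
  set a := A.toReal + ε / N with ha
  have ha0 : 0 < a := by positivity
  have hAa : MorreyNorm d q β Q (fun w => f w + c * g w) ≤ ENNReal.ofReal a := by
    refine hadd.trans ?_
    rw [← ENNReal.ofReal_toReal hAt]
    exact ENNReal.ofReal_le_ofReal (by rw [ha]; simp only [le_add_iff_nonneg_right]; positivity)
  have hfin : ENNReal.ofReal N * A + ε = ENNReal.ofReal (N * a) := by
    rw [ha, mul_add, mul_div_cancel₀ (ε : ℝ) hNp.ne', ENNReal.ofReal_add (by positivity) (by positivity),
      ENNReal.ofReal_mul hNp.le, ENNReal.ofReal_toReal hAt, ENNReal.ofReal_coe_nnreal]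
  rw [hfin]
  have hpot' := hpot (Q.indicator fun w => f w + c * g w) (2 ^ (d + 2) * a)
    ((mf.add (mg.const_mul c)).indicator hQm) (by positivity)
    (fun ρ z hρ => morrey_sym d hq hβ ha0 hAa hρ z)
  refine iSup_le fun R => iSup_le fun hR => iSup_le fun z => iSup_le fun hz => ?_
  have hp : (pAvg d R z fun w => Q.indicator (fun z => ENNReal.ofReal (gradNorm d u z)) w ^ r) ≤
      ENNReal.ofReal ((2 * K ^ r * N0) * (2 ^ (d + 2) * a * R ^ (1 - β)) ^ r) := by
    calc _ ≤ 2 * sAvg d R z fun w => Q.indicator (fun z => ENNReal.ofReal (gradNorm d u z)) w ^ r :=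
          pAvg_le_sAvg d hR z _
      _ ≤ 2 * sAvg d R z fun w => ENNReal.ofReal (K ^ r) *
            JP d (Q.indicator fun w => f w + c * g w) w ^ r := by
          refine mul_le_mul_right (sAvg_mono fun w _ => ?_) _
          rw [← ENNReal.ofReal_rpow_of_pos hK, ← ENNReal.mul_rpow_of_nonneg _ _ hr0.le]
          refine ENNReal.rpow_le_rpow ?_ hr0.le
          by_cases hw : w ∈ Q
          · rw [indicator_of_mem hw]
            exact hdom u hu S T hST w hw
          · simp [hw]
      _ ≤ 2 * (ENNReal.ofReal (K ^ r) *
            ENNReal.ofReal (N0 * (2 ^ (d + 2) * a * R ^ (1 - β)) ^ r)) := by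
          rw [sAvg_const_mul _ _ _ (by simp)]
          exact mul_le_mul_right (mul_le_mul_right (hpot' R z hR) _) _
      _ = _ := by
          rw [← ENNReal.ofReal_mul (by positivity), ← ENNReal.ofReal_ofNat 2,
            ← ENNReal.ofReal_mul (by norm_num)]
          congr 1; ring
  calc _ ≤ ENNReal.ofReal (R ^ (β - 1)) *
        ENNReal.ofReal ((2 * K ^ r * N0) * (2 ^ (d + 2) * a * R ^ (1 - β)) ^ r) ^ (1 / r) :=
        mul_le_mul_right (ENNReal.rpow_le_rpow hp (by positivity)) _
    _ = ENNReal.ofReal (N * a) := by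
        rw [ENNReal.ofReal_rpow_of_nonneg (by positivity) (by positivity),
          ← ENNReal.ofReal_mul (by positivity)]
        congr 1
        rw [Real.mul_rpow (by positivity) (by positivity), ← Real.rpow_mul (by positivity),
          mul_one_div_cancel hr0.ne', Real.rpow_one]
        have : R ^ (β - 1) * R ^ (1 - β) = 1 := by
          rw [← Real.rpow_add hR]; simp
        rw [hN]
        linear_combination ((2 * K ^ r * N0) ^ (1 / r) * 2 ^ (d + 2) * a) * this
    _ ≤ _ := le_rfl

end
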